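/- Let n ≥ 1, δ > (n-1)/2, q ∈ (0,1], p ∈ [q,∞), and assume 2n/(n+1+2δ) ≤ q. Then there exists a constant C > 0 such that for every Schwartz function f on ℝ^n and every ε > 0, ‖M(B^δ_{1/ε}(f), Φ)‖_{WM^p_q} ≤ C ‖M(f,Φ)‖_{M^p_q}; that is, the Bochner–Riesz means of order δ is bounded from the Hardy–Morrey space HM^p_q(ℝ^n) to the weak Hardy–Morrey space WHM^p_q(ℝ^n), uniformly in ε. -/

import Mathlib

noncomputable section

open MeasureTheory Real Set
open scoped ENNReal NNReal

abbrev En (n : ℕ) : Type := EuclideanSpace ℝ (Fin n)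

/-- The Bochner–Riesz kernel of order `δ`: the Fourier transform of `ξ ↦ ((1-|ξ|²)⁺)^δ`. -/
def brKernel (n : ℕ) (δ : ℝ) (x : En n) : ℂ :=
  ∫ ξ : En n, (((max (1 - ‖ξ‖ ^ 2) 0) ^ δ : ℝ) : ℂ) *
    Complex.exp (-(2 * Real.pi) * Complex.I * ((∑ i, x i * ξ i : ℝ) : ℂ))

/-- The dilated kernel `φ_ε(x) = ε^{-n} φ(x/ε)`. -/
def brKernelDil (n : ℕ) (δ ε : ℝ) (x : En n) : ℂ :=
  (ε ^ n)⁻¹ • brKernel n δ (ε⁻¹ • x)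

/-- The Bochner–Riesz means `B^δ_{1/ε} f = f * φ_ε`. -/
def brMeans (n : ℕ) (δ ε : ℝ) (f : En n → ℂ) (x : En n) : ℂ :=
  ∫ y, f y * brKernelDil n δ ε (x - y)

/-- The maximal Bochner–Riesz means `B^δ_* f`. -/
def brMax (n : ℕ) (δ : ℝ) (f : En n → ℂ) (x : En n) : ℝ≥0∞ :=
  ⨆ (ε : ℝ) (_ : 0 < ε), (‖brMeans n δ ε f x‖₊ : ℝ≥0∞)

/-- The radial maximal function `M(f,Φ)(x) = sup_{t>0} |(Φ_t * f)(x)|`. -/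
def radMax (n : ℕ) (Φ : En n → ℂ) (f : En n → ℂ) (x : En n) : ℝ≥0∞ :=
  ⨆ (t : ℝ) (_ : 0 < t), (‖∫ y, (t ^ n)⁻¹ • Φ (t⁻¹ • (x - y)) * f y‖₊ : ℝ≥0∞)

/-- The Morrey quasinorm `‖g‖_{M^p_q}` of a nonnegative function. -/
def morreyQ (n : ℕ) (p q : ℝ) (g : En n → ℝ≥0∞) : ℝ≥0∞ :=
  ⨆ (x : En n) (r : ℝ) (_ : 0 < r),
    (volume (Metric.ball x r)) ^ (1/p - 1/q) *
      (∫⁻ y in Metric.ball x r, g y ^ q) ^ (1/q)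

/-- The weak Morrey quasinorm `‖g‖_{WM^p_q}`. -/
def morreyWQ (n : ℕ) (p q : ℝ) (g : En n → ℝ≥0∞) : ℝ≥0∞ :=
  ⨆ (β : ℝ≥0) (_ : 0 < β),
    (β : ℝ≥0∞) * morreyQ n p q ({x | (β : ℝ≥0∞) < g x}.indicator 1)


/-- oscillating exponential -/
def osc (ω s : ℝ) : ℂ := Complex.exp (Complex.I * ((ω * s : ℝ) : ℂ))

lemma osc_norm (ω s : ℝ) : ‖osc ω s‖ = 1 := by
  unfold osc
  rw [mul_comm, Complex.norm_exp_ofReal_mul_I]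

lemma osc_hasDeriv (ω s : ℝ) : HasDerivAt (osc ω) (Complex.I * ω * osc ω s) s := by
  unfold osc
  have h1 : HasDerivAt (fun s : ℝ => Complex.I * ((ω * s : ℝ) : ℂ)) (Complex.I * ω) s := by
    have : HasDerivAt (fun s : ℝ => ω * s) (ω * 1) s := (hasDerivAt_id s).const_mul ω
    have := this.ofReal_comp.const_mul Complex.I
    simpa using this
  have := h1.cexp
  convert this using 1
  ring

lemma osc_cont (ω : ℝ) : Continuous (osc ω) := by
  unfold osc; fun_prop

lemma osc_neg (ω s : ℝ) : osc ω (-s) = osc (-ω) s := by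
  unfold osc; congr 2; push_cast; ring

lemma intInt_one_sub (μ : ℝ) (hμ : -1 < μ) (a b : ℝ) :
    IntervalIntegrable (fun s : ℝ => (1 - s) ^ μ) volume a b := by
  have := (intervalIntegral.intervalIntegrable_rpow' (a := 1 - a) (b := 1 - b) hμ).comp_sub_left 1
  simpa using this

lemma integral_one_sub (μ : ℝ) (hμ : -1 < μ) (h : ℝ) :
    ∫ s in (1 - h)..1, (1 - s) ^ μ = h ^ (μ + 1) / (μ + 1) := by
  rw [intervalIntegral.integral_comp_sub_left (fun s => s ^ μ) 1, integral_rpow (Or.inl hμ)]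
  simp only [sub_self, sub_sub_cancel]
  rw [Real.zero_rpow (by linarith)]
  simp

lemma osc_half (g g' : ℝ → ℝ) (μ : ℝ) (hμ : -1 < μ)
    (hd : ∀ s ∈ Ico (0:ℝ) 1, HasDerivAt g (g' s) s)
    (hg'c : ContinuousOn g' (Ico 0 1)) (hg'0 : ∀ s ∈ Ico (0:ℝ) 1, 0 ≤ g' s) (h0 : 0 ≤ g 0)
    (hb : ∀ s ∈ Ico (0:ℝ) 1, g s ≤ (1 - s) ^ μ) :
    IntervalIntegrable g volume 0 1 ∧ ∀ ω : ℝ, 2 ≤ |ω| →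
    ‖∫ s in (0:ℝ)..1, (g s : ℂ) * osc ω s‖ ≤ (2 + 1 / (μ + 1)) * |ω| ^ (-μ - 1) := by
  have hgc : ContinuousOn g (Ico 0 1) := fun s hs => (hd s hs).continuousAt.continuousWithinAt
  have hmono : MonotoneOn g (Ico 0 1) := by
    apply monotoneOn_of_deriv_nonneg (convex_Ico 0 1) hgc
    · intro s hs; rw [interior_Ico] at hs
      exact (hd s (Ioo_subset_Ico_self hs)).differentiableAt.differentiableWithinAt
    · intro s hs; rw [interior_Ico] at hs
      rw [(hd s (Ioo_subset_Ico_self hs)).deriv]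
      exact hg'0 s (Ioo_subset_Ico_self hs)
  have hpos : ∀ s ∈ Ico (0:ℝ) 1, 0 ≤ g s := fun s hs =>
    h0.trans (hmono ⟨le_rfl, one_pos⟩ hs hs.1)
  have hgint : IntervalIntegrable g volume 0 1 := by
    rw [intervalIntegrable_iff_integrableOn_Ico_of_le zero_le_one]
    have h1 := (intInt_one_sub μ hμ 0 1)
    rw [intervalIntegrable_iff_integrableOn_Ico_of_le zero_le_one] at h1
    refine Integrable.mono' h1 (hgc.aestronglyMeasurable measurableSet_Ico) ?_
    filter_upwards [ae_restrict_mem measurableSet_Ico] with s hs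
    rw [Real.norm_of_nonneg (hpos s hs)]
    exact hb s hs
  refine ⟨hgint, fun ω hω => ?_⟩
  have hω0 : 0 < |ω| := by linarith
  have hωne : ω ≠ 0 := abs_pos.mp hω0
  set h : ℝ := |ω|⁻¹ with hh
  have hh0 : 0 < h := inv_pos.mpr hω0
  have hh1 : h ≤ 1/2 := by
    rw [hh, one_div]; exact inv_anti₀ two_pos hω
  have hGint : IntervalIntegrable (fun s => (g s : ℂ) * osc ω s) volume 0 1 := by
    apply IntervalIntegrable.mul_continuousOn _ (osc_cont ω).continuousOn
    exact ⟨hgint.1.ofReal, hgint.2.ofReal⟩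
  have hsub1 : uIcc (0:ℝ) (1 - h) ⊆ uIcc 0 1 := by
    rw [uIcc_of_le (by linarith), uIcc_of_le zero_le_one]
    exact Icc_subset_Icc le_rfl (by linarith)
  have hsub2 : uIcc (1 - h) 1 ⊆ uIcc (0:ℝ) 1 := by
    rw [uIcc_of_le (by linarith), uIcc_of_le zero_le_one]
    exact Icc_subset_Icc (by linarith) le_rfl
  rw [← intervalIntegral.integral_add_adjacent_intervals (hGint.mono_set hsub1)
    (hGint.mono_set hsub2)]
  have hsub3 : Icc (0:ℝ) (1 - h) ⊆ Ico 0 1 := fun s hs => ⟨hs.1, by linarith [hs.2]⟩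
  have e1 : (1 - h) ∈ Ico (0:ℝ) 1 := ⟨by linarith, by linarith⟩
  have hpw : |ω| ^ (-μ - 1) = h ^ (μ + 1) := by
    rw [hh, Real.inv_rpow hω0.le, ← Real.rpow_neg hω0.le]; congr 1; ring
  have hA : ‖∫ s in (0:ℝ)..(1 - h), (g s : ℂ) * osc ω s‖ ≤ 2 * h ^ (μ + 1) := by
    have hg'int : IntervalIntegrable g' volume 0 (1 - h) := by
      apply ContinuousOn.intervalIntegrable
      rw [uIcc_of_le (by linarith)]
      exact hg'c.mono hsub3
    have hwne : (Complex.I * ω : ℂ) ≠ 0 := by simp [hωne]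
    have key := intervalIntegral.integral_mul_deriv_eq_deriv_mul_of_hasDerivAt
      (a := (0:ℝ)) (b := 1 - h) (u := fun s => (g s : ℂ)) (u' := fun s => (g' s : ℂ))
      (v := fun s => (Complex.I * ω)⁻¹ * osc ω s) (v' := fun s => osc ω s)
      (by
        rw [uIcc_of_le (by linarith)]
        exact Complex.continuous_ofReal.comp_continuousOn (hgc.mono hsub3))
      (continuous_const.mul (osc_cont ω)).continuousOn
      (by
        intro s hs
        rw [min_eq_left (by linarith), max_eq_right (by linarith)] at hs
        exact (hd s (hsub3 (Ioo_subset_Icc_self hs))).ofReal_comp)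
      (by
        intro s hs
        have := (osc_hasDeriv ω s).const_mul (Complex.I * ω : ℂ)⁻¹
        rwa [inv_mul_cancel_left₀ hwne] at this)
      ⟨hg'int.1.ofReal, hg'int.2.ofReal⟩
      ((osc_cont ω).intervalIntegrable _ _)
    rw [key]
    have hn : ∀ s, ‖(Complex.I * ω : ℂ)⁻¹ * osc ω s‖ = h := by
      intro s; rw [norm_mul, osc_norm]; simp [hh]
    have hI : ‖∫ s in (0:ℝ)..(1 - h), (g' s : ℂ) * ((Complex.I * ω : ℂ)⁻¹ * osc ω s)‖
        ≤ h * (g (1 - h) - g 0) := by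
      have hftc : ∫ s in (0:ℝ)..(1 - h), g' s = g (1 - h) - g 0 := by
        apply intervalIntegral.integral_eq_sub_of_hasDerivAt _ hg'int
        intro s hs
        rw [uIcc_of_le (by linarith)] at hs
        exact hd s (hsub3 hs)
      rw [← hftc, ← intervalIntegral.integral_const_mul]
      apply intervalIntegral.norm_integral_le_of_norm_le (by linarith) _ (hg'int.const_mul h)
      filter_upwards with s hs
      rw [norm_mul, hn, Complex.norm_real, Real.norm_of_nonneg
        (hg'0 s (hsub3 (Ioc_subset_Icc_self hs))), mul_comm]
    have n1 : ‖(g (1 - h) : ℂ) * ((Complex.I * ω : ℂ)⁻¹ * osc ω (1 - h))‖ = g (1 - h) * h := by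
      rw [norm_mul, hn, Complex.norm_real, Real.norm_of_nonneg (hpos _ e1)]
    have n0 : ‖(g 0 : ℂ) * ((Complex.I * ω : ℂ)⁻¹ * osc ω 0)‖ = g 0 * h := by
      rw [norm_mul, hn, Complex.norm_real, Real.norm_of_nonneg h0]
    refine (norm_sub_le _ _).trans ?_
    refine (add_le_add_left (norm_sub_le _ _) _).trans ?_
    rw [n1, n0]
    have hb1 := hb _ e1
    rw [sub_sub_cancel] at hb1
    have : h ^ (μ + 1) = h ^ μ * h := by rw [Real.rpow_add_one hh0.ne']
    rw [this]
    nlinarith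
  have hB : ‖∫ s in (1 - h)..1, (g s : ℂ) * osc ω s‖ ≤ h ^ (μ + 1) / (μ + 1) := by
    rw [← integral_one_sub μ hμ h]
    apply intervalIntegral.norm_integral_le_of_norm_le (by linarith) _ (intInt_one_sub μ hμ _ _)
    have hae : ∀ᵐ s : ℝ, s ≠ 1 := by
      simp [ae_iff, measure_singleton]
    filter_upwards [hae] with s hs1 hs
    have hs' : s ∈ Ico (0:ℝ) 1 := ⟨by linarith [hs.1], lt_of_le_of_ne hs.2 hs1⟩
    rw [norm_mul, osc_norm, mul_one, Complex.norm_real, Real.norm_of_nonneg (hpos _ hs')]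
    exact hb s hs'
  refine (norm_add_le _ _).trans ((add_le_add hA hB).trans ?_)
  rw [hpw]
  apply le_of_eq; ring



def oI (μ ω : ℝ) : ℂ := ∫ s in (-1:ℝ)..1, (((1 - s ^ 2) ^ μ : ℝ) : ℂ) * osc ω s
def oS (μ ω : ℝ) : ℂ := ∫ s in (-1:ℝ)..1, ((s * (1 - s ^ 2) ^ μ : ℝ) : ℂ) * osc ω s

def Dec (μ : ℝ) : Prop := ∃ C : ℝ, 0 ≤ C ∧ ∀ ω : ℝ, 2 ≤ |ω| →
  ‖oI μ ω‖ ≤ C * |ω| ^ (-μ - 1) ∧ ‖oS μ ω‖ ≤ C * |ω| ^ (-μ - 1)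

lemma w_pos {s : ℝ} (hs : s ∈ Ioo (-1:ℝ) 1) : 0 < 1 - s ^ 2 := by
  nlinarith [hs.1, hs.2]

lemma w_deriv (μ : ℝ) {s : ℝ} (hs : s ∈ Ioo (-1:ℝ) 1) :
    HasDerivAt (fun s : ℝ => (1 - s ^ 2) ^ μ) (μ * (1 - s ^ 2) ^ (μ - 1) * (-2 * s)) s := by
  have h1 : HasDerivAt (fun s : ℝ => 1 - s ^ 2) (-2 * s) s := by
    have := (hasDerivAt_pow 2 s).const_sub 1
    simpa using this
  have := h1.rpow_const (p := μ) (Or.inl (w_pos hs).ne')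
  convert this using 1
  ring

lemma sw_deriv (μ : ℝ) {s : ℝ} (hs : s ∈ Ioo (-1:ℝ) 1) :
    HasDerivAt (fun s : ℝ => s * (1 - s ^ 2) ^ μ)
      ((1 - s ^ 2) ^ μ + s * (μ * (1 - s ^ 2) ^ (μ - 1) * (-2 * s))) s := by
  have := (hasDerivAt_id' s).fun_mul (w_deriv μ hs)
  rwa [one_mul] at this

lemma w_contOn (μ : ℝ) : ContinuousOn (fun s : ℝ => (1 - s ^ 2) ^ μ) (Ioo (-1) 1) :=
  fun _ hs => (w_deriv μ hs).continuousAt.continuousWithinAt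

lemma Ico_sub : Ico (0:ℝ) 1 ⊆ Ioo (-1) 1 := fun s hs => ⟨by linarith [hs.1], hs.2⟩

lemma w_le (μ : ℝ) (hμ : μ ≤ 0) {s : ℝ} (hs : s ∈ Ico (0:ℝ) 1) :
    (1 - s ^ 2) ^ μ ≤ (1 - s) ^ μ := by
  apply Real.rpow_le_rpow_of_nonpos (by linarith [hs.2]) _ hμ
  nlinarith [hs.1, hs.2]

lemma base_w (μ : ℝ) (hμ : -1 < μ) (hμ0 : μ ≤ 0) :
    IntervalIntegrable (fun s : ℝ => (1 - s ^ 2) ^ μ) volume 0 1 ∧ ∀ ω : ℝ, 2 ≤ |ω| →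
    ‖∫ s in (0:ℝ)..1, (((1 - s ^ 2) ^ μ : ℝ) : ℂ) * osc ω s‖
      ≤ (2 + 1 / (μ + 1)) * |ω| ^ (-μ - 1) := by
  apply osc_half (fun s : ℝ => (1 - s ^ 2) ^ μ) _ μ hμ (fun s hs => w_deriv μ (Ico_sub hs))
  · exact ((continuousOn_const.mul ((w_contOn (μ - 1)).mono Ico_sub)).mul
      (continuous_const.mul continuous_id).continuousOn)
  · intro s hs
    have := (Real.rpow_pos_of_pos (w_pos (Ico_sub hs)) (μ - 1)).le
    have h2 : μ * (1 - s ^ 2) ^ (μ - 1) ≤ 0 := mul_nonpos_of_nonpos_of_nonneg hμ0 this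
    nlinarith [hs.1]
  · simp
  · intro s hs; exact w_le μ hμ0 hs

lemma base_sw (μ : ℝ) (hμ : -1 < μ) (hμ0 : μ ≤ 0) :
    IntervalIntegrable (fun s : ℝ => s * (1 - s ^ 2) ^ μ) volume 0 1 ∧ ∀ ω : ℝ, 2 ≤ |ω| →
    ‖∫ s in (0:ℝ)..1, ((s * (1 - s ^ 2) ^ μ : ℝ) : ℂ) * osc ω s‖
      ≤ (2 + 1 / (μ + 1)) * |ω| ^ (-μ - 1) := by
  apply osc_half (fun s : ℝ => s * (1 - s ^ 2) ^ μ) _ μ hμ (fun s hs => sw_deriv μ (Ico_sub hs))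
  · exact ((w_contOn μ).mono Ico_sub).add (continuousOn_id.mul
      ((continuousOn_const.mul ((w_contOn (μ - 1)).mono Ico_sub)).mul
      (continuous_const.mul continuous_id).continuousOn))
  · intro s hs
    have := (Real.rpow_pos_of_pos (w_pos (Ico_sub hs)) (μ - 1)).le
    have h3 := (Real.rpow_pos_of_pos (w_pos (Ico_sub hs)) μ).le
    have h2 : 0 ≤ (-μ) * (1 - s ^ 2) ^ (μ - 1) := mul_nonneg (by linarith) this
    nlinarith [hs.1, mul_nonneg h2 (mul_nonneg hs.1 hs.1)]
  · simp
  · intro s hs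
    have h3 := (Real.rpow_pos_of_pos (w_pos (Ico_sub hs)) μ).le
    have := w_le μ hμ0 hs
    nlinarith [hs.1, hs.2]

lemma w_int (μ : ℝ) (hμ : -1 < μ) :
    IntervalIntegrable (fun s : ℝ => (1 - s ^ 2) ^ μ) volume (-1) 1 := by
  rcases le_or_gt μ 0 with h | h
  · have h1 := (base_w μ hμ h).1
    have h2 := h1.comp_sub_left 0
    simp only [zero_sub, even_two, Even.neg_pow, sub_zero] at h2
    have h3 := h2.symm
    exact h3.trans h1
  · apply Continuous.intervalIntegrable
    exact (by fun_prop : Continuous fun s : ℝ => 1 - s ^ 2).rpow_const (fun _ => Or.inr h.le)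

lemma sw_int (μ : ℝ) (hμ : -1 < μ) :
    IntervalIntegrable (fun s : ℝ => s * (1 - s ^ 2) ^ μ) volume (-1) 1 :=
  (w_int μ hμ).continuousOn_mul continuousOn_id

lemma ofReal_osc_int {g : ℝ → ℝ} {a b : ℝ} (hg : IntervalIntegrable g volume a b) (ω : ℝ) :
    IntervalIntegrable (fun s => (g s : ℂ) * osc ω s) volume a b := by
  apply IntervalIntegrable.mul_continuousOn _ (osc_cont ω).continuousOn
  exact ⟨hg.1.ofReal, hg.2.ofReal⟩

lemma split_bound (g : ℝ → ℝ) (σ : ℝ) (hσ : |σ| = 1) (hg : IntervalIntegrable g volume (-1) 1)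
    (hsym : ∀ s, g (-s) = σ * g s) (K e : ℝ)
    (h : ∀ ω : ℝ, 2 ≤ |ω| → ‖∫ s in (0:ℝ)..1, (g s : ℂ) * osc ω s‖ ≤ K * |ω| ^ e) (ω : ℝ)
    (hω : 2 ≤ |ω|) :
    ‖∫ s in (-1:ℝ)..1, (g s : ℂ) * osc ω s‖ ≤ (2 * K) * |ω| ^ e := by
  have hi := ofReal_osc_int hg ω
  have i1 : IntervalIntegrable (fun s => (g s : ℂ) * osc ω s) volume (-1) 0 :=
    hi.mono_set (by
      rw [uIcc_of_le (by norm_num), uIcc_of_le (by norm_num)]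
      exact Icc_subset_Icc le_rfl zero_le_one)
  have i2 : IntervalIntegrable (fun s => (g s : ℂ) * osc ω s) volume 0 1 :=
    hi.mono_set (by
      rw [uIcc_of_le (by norm_num), uIcc_of_le (by norm_num)]
      exact Icc_subset_Icc (by norm_num) le_rfl)
  rw [← intervalIntegral.integral_add_adjacent_intervals i1 i2]
  have e1 : ∫ s in (-1:ℝ)..0, (g s : ℂ) * osc ω s
      = (σ : ℂ) * ∫ s in (0:ℝ)..1, (g s : ℂ) * osc (-ω) s := by
    have := intervalIntegral.integral_comp_neg (a := (0:ℝ)) (b := 1)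
      (fun s => (g s : ℂ) * osc ω s)
    rw [neg_zero] at this
    rw [← this, ← intervalIntegral.integral_const_mul]
    congr 1; ext s
    rw [hsym, osc_neg]; push_cast; ring
  rw [e1]
  refine (norm_add_le _ _).trans ?_
  rw [norm_mul, Complex.norm_real, Real.norm_eq_abs, hσ, one_mul]
  have a1 := h (-ω) (by rwa [abs_neg])
  have a2 := h ω hω
  rw [abs_neg] at a1
  linarith

lemma dec_base (μ : ℝ) (hμ : -1 < μ) (hμ0 : μ ≤ 0) : Dec μ := by
  refine ⟨2 * (2 + 1 / (μ + 1)), ?_, fun ω hω => ⟨?_, ?_⟩⟩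
  · have : 0 < 1 / (μ + 1) := by apply one_div_pos.mpr; linarith
    positivity
  · exact split_bound _ 1 (by simp) (w_int μ hμ) (by intro s; simp) _ _ (base_w μ hμ hμ0).2 ω hω
  · exact split_bound _ (-1) (by simp) (sw_int μ hμ) (by intro s; simp) _ _
      (base_sw μ hμ hμ0).2 ω hω

lemma ibp (g g' : ℝ → ℝ) (hgc : ContinuousOn g (Icc (-1) 1))
    (hd : ∀ s ∈ Ioo (-1:ℝ) 1, HasDerivAt g (g' s) s)
    (hi : IntervalIntegrable g' volume (-1) 1) (h1 : g 1 = 0) (h2 : g (-1) = 0) (ω : ℝ) :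
    Complex.I * ω * ∫ s in (-1:ℝ)..1, (g s : ℂ) * osc ω s
      = - ∫ s in (-1:ℝ)..1, (g' s : ℂ) * osc ω s := by
  have key := intervalIntegral.integral_mul_deriv_eq_deriv_mul_of_hasDerivAt
      (a := (-1:ℝ)) (b := 1) (u := fun s => (g s : ℂ)) (u' := fun s => (g' s : ℂ))
      (v := fun s => osc ω s) (v' := fun s => Complex.I * ω * osc ω s)
      (by
        rw [uIcc_of_le (by norm_num)]
        exact Complex.continuous_ofReal.comp_continuousOn hgc)
      (osc_cont ω).continuousOn
      (by
        intro s hs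
        rw [min_eq_left (by norm_num), max_eq_right (by norm_num)] at hs
        exact (hd s hs).ofReal_comp)
      (by intro s _; exact osc_hasDeriv ω s)
      ⟨hi.1.ofReal, hi.2.ofReal⟩
      ((continuous_const.mul (osc_cont ω)).intervalIntegrable _ _)
  simp only [h1, h2, Complex.ofReal_zero, zero_mul, sub_zero, zero_sub] at key
  rw [← key, ← intervalIntegral.integral_const_mul]
  congr 1; ext s; ring

lemma dec_step (μ : ℝ) (hμ : -1 < μ) (h : Dec μ) : Dec (μ + 1) := by
  obtain ⟨C, hC, h⟩ := h
  have hcont : Continuous (fun s : ℝ => (1 - s ^ 2) ^ (μ + 1)) :=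
    (by fun_prop : Continuous fun s : ℝ => 1 - s ^ 2).rpow_const
      (fun _ => Or.inr (by linarith))
  have z : (0:ℝ) ^ (μ + 1) = 0 := Real.zero_rpow (by linarith)
  have r1 : ∀ ω : ℝ, Complex.I * ω * oI (μ + 1) ω = 2 * (μ + 1) * oS μ ω := by
    intro ω
    have := ibp (fun s => (1 - s ^ 2) ^ (μ + 1)) (fun s => (-2 * (μ + 1)) * (s * (1 - s ^ 2) ^ μ))
      hcont.continuousOn (by
        intro s hs
        convert w_deriv (μ + 1) hs using 1
        rw [add_sub_cancel_right]; ring) ((sw_int μ hμ).const_mul _) (by simp [z]) (by simp [z]) ω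
    unfold oI oS
    rw [this, ← intervalIntegral.integral_neg, ← intervalIntegral.integral_const_mul]
    congr 1; ext s; push_cast; ring
  have r2 : ∀ ω : ℝ, Complex.I * ω * oS (μ + 1) ω
      = 2 * (μ + 1) * oI μ ω - (2 * μ + 3) * oI (μ + 1) ω := by
    intro ω
    have := ibp (fun s => s * (1 - s ^ 2) ^ (μ + 1))
      (fun s => (2 * μ + 3) * (1 - s ^ 2) ^ (μ + 1) - (2 * (μ + 1)) * (1 - s ^ 2) ^ μ)
      (continuous_id.mul hcont).continuousOn (by
        intro s hs
        convert sw_deriv (μ + 1) hs using 1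
        rw [add_sub_cancel_right, Real.rpow_add_one (w_pos hs).ne']; ring)
        (((w_int (μ + 1) (by linarith)).const_mul _).sub ((w_int μ hμ).const_mul _))
        (by simp [z]) (by simp [z]) ω
    unfold oI oS
    rw [this, ← intervalIntegral.integral_neg, ← intervalIntegral.integral_const_mul,
      ← intervalIntegral.integral_const_mul, ← intervalIntegral.integral_sub]
    · congr 1; ext s; push_cast; ring
    · exact (ofReal_osc_int (w_int μ hμ) ω).const_mul _
    · exact (ofReal_osc_int (w_int (μ + 1) (by linarith)) ω).const_mul _
  have hμ1 : 0 < μ + 1 := by linarith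
  set C1 := 2 * (μ + 1) * C with hC1
  have hC10 : 0 ≤ C1 := by positivity
  have b1 : ∀ ω : ℝ, 2 ≤ |ω| → ‖oI (μ + 1) ω‖ ≤ C1 * |ω| ^ (-(μ + 1) - 1) := by
    intro ω hω
    have hω0 : 0 < |ω| := by linarith
    have := congrArg norm (r1 ω)
    rw [norm_mul, norm_mul, norm_mul, Complex.norm_I, one_mul, Complex.norm_real,
      Real.norm_eq_abs] at this
    have n2 : ‖(2 * (μ + 1) : ℂ)‖ = 2 * (μ + 1) := by
      rw [show (2 * (μ + 1) : ℂ) = ((2 * (μ + 1) : ℝ) : ℂ) by push_cast; ring,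
        Complex.norm_real, Real.norm_of_nonneg (by positivity)]
    rw [n2] at this
    have hS := (h ω hω).2
    have e : |ω| ^ (-μ - 1) = |ω| ^ (-(μ + 1) - 1) * |ω| := by
      rw [← Real.rpow_add_one hω0.ne']; congr 1; ring
    rw [e] at hS
    have : |ω| * ‖oI (μ + 1) ω‖ ≤ |ω| * (C1 * |ω| ^ (-(μ + 1) - 1)) := by
      rw [this, hC1]
      calc 2 * (μ + 1) * ‖oS μ ω‖ ≤ 2 * (μ + 1) * (C * (|ω| ^ (-(μ + 1) - 1) * |ω|)) := by gcongr
        _ = _ := by ring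
    exact le_of_mul_le_mul_left this hω0
  set C2 := 2 * (μ + 1) * C + (2 * μ + 3) * C1 with hC2
  have hC20 : 0 ≤ C2 := by
    have : 0 ≤ 2 * μ + 3 := by linarith
    positivity
  refine ⟨C1 + C2, by positivity, fun ω hω => ⟨?_, ?_⟩⟩
  · refine (b1 ω hω).trans ?_
    have : 0 ≤ |ω| ^ (-(μ + 1) - 1) := by positivity
    nlinarith
  · have hω0 : 0 < |ω| := by linarith
    have := congrArg norm (r2 ω)
    rw [norm_mul, norm_mul, Complex.norm_I, one_mul, Complex.norm_real,
      Real.norm_eq_abs] at this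
    have n2 : ‖(2 * (μ + 1) : ℂ)‖ = 2 * (μ + 1) := by
      rw [show (2 * (μ + 1) : ℂ) = ((2 * (μ + 1) : ℝ) : ℂ) by push_cast; ring,
        Complex.norm_real, Real.norm_of_nonneg (by positivity)]
    have n3 : ‖(2 * μ + 3 : ℂ)‖ = 2 * μ + 3 := by
      rw [show (2 * μ + 3 : ℂ) = ((2 * μ + 3 : ℝ) : ℂ) by push_cast; ring,
        Complex.norm_real, Real.norm_of_nonneg (by linarith)]
    have hI := (h ω hω).1
    have hI1 := b1 ω hω
    set X := |ω| ^ (-(μ + 1) - 1) with hX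
    have hX0 : 0 ≤ X := by positivity
    have e : |ω| ^ (-μ - 1) = X * |ω| := by
      rw [hX, ← Real.rpow_add_one hω0.ne']; congr 1; ring
    rw [e] at hI
    have h3 : 0 ≤ 2 * μ + 3 := by linarith
    have : |ω| * ‖oS (μ + 1) ω‖ ≤ |ω| * (C2 * X) := by
      rw [this]
      refine (norm_sub_le _ _).trans ?_
      rw [norm_mul _ (oI μ ω), norm_mul _ (oI (μ + 1) ω), n2, n3]
      calc 2 * (μ + 1) * ‖oI μ ω‖ + (2 * μ + 3) * ‖oI (μ + 1) ω‖
          ≤ 2 * (μ + 1) * (C * (X * |ω|)) + (2 * μ + 3) * (C1 * X) := by gcongr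
        _ ≤ 2 * (μ + 1) * (C * (X * |ω|)) + (2 * μ + 3) * (C1 * (X * |ω|)) := by
            gcongr
            nlinarith
        _ = _ := by rw [hC2]; ring
    have := le_of_mul_le_mul_left this hω0
    nlinarith

lemma dec_all (ν : ℝ) (hν : -1 < ν) : Dec ν := by
  have aux : ∀ k : ℕ, ∀ μ : ℝ, -1 < μ → μ ≤ 0 → Dec (μ + k) := by
    intro k
    induction k with
    | zero => intro μ h1 h2; simpa using dec_base μ h1 h2
    | succ k ih =>
      intro μ h1 h2
      have := dec_step (μ + k) (by have : (0:ℝ) ≤ k := Nat.cast_nonneg k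
                                   linarith) (ih μ h1 h2)
      convert this using 1; push_cast; ring
  rcases le_or_gt ν 0 with h | h
  · exact dec_base ν hν h
  · have := aux ⌈ν⌉₊ (ν - ⌈ν⌉₊) (by have := Nat.ceil_lt_add_one h.le; linarith)
      (by have := Nat.le_ceil ν; linarith)
    simpa using this



/-- Bochner-Riesz multiplier. -/
def brm (n : ℕ) (δ : ℝ) (ξ : En n) : ℝ := (max (1 - ‖ξ‖ ^ 2) 0) ^ δ

lemma brm_cont (n : ℕ) (δ : ℝ) (hδ : 0 < δ) : Continuous (brm n δ) := by
  unfold brm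
  exact Continuous.rpow_const (by fun_prop) (fun x => Or.inr hδ.le)

lemma brm_supp (n : ℕ) (δ : ℝ) (hδ : 0 < δ) (ξ : En n) (h : 1 ≤ ‖ξ‖) : brm n δ ξ = 0 := by
  unfold brm
  rw [max_eq_right (by nlinarith), Real.zero_rpow hδ.ne']

lemma brm_nonneg (n : ℕ) (δ : ℝ) (ξ : En n) : 0 ≤ brm n δ ξ := by
  unfold brm; positivity

lemma brm_cs (n : ℕ) (δ : ℝ) (hδ : 0 < δ) : HasCompactSupport (brm n δ) := by
  apply HasCompactSupport.intro (isCompact_closedBall (0 : En n) 1)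
  intro x hx
  apply brm_supp n δ hδ
  simp at hx
  exact hx.le

lemma brm_integrable (n : ℕ) (δ : ℝ) (hδ : 0 < δ) : Integrable (brm n δ) :=
  (brm_cont n δ hδ).integrable_of_hasCompactSupport (brm_cs n δ hδ)

lemma brKernel_bdd (n : ℕ) (δ : ℝ) (x : En n) :
    ‖brKernel n δ x‖ ≤ ∫ ξ, brm n δ ξ := by
  unfold brKernel
  refine (norm_integral_le_integral_norm _).trans (le_of_eq ?_)
  congr 1; ext ξ
  rw [norm_mul, show (-(2 * (π:ℂ)) * Complex.I * ((∑ i, x i * ξ i : ℝ) : ℂ)) =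
    ((-(2*π) * (∑ i, x i * ξ i) : ℝ) : ℂ) * Complex.I by push_cast; ring, Complex.norm_exp_ofReal_mul_I, mul_one]
  rw [Complex.norm_real, Real.norm_of_nonneg (by positivity)]; rfl

lemma exp_osc (x ξ : ℝ) : Complex.exp (-(2 * (π:ℂ)) * Complex.I * ((x * ξ : ℝ) : ℂ)) = osc (-(2*π*x)) ξ := by
  unfold osc
  congr 1; push_cast; ring

lemma brKernel_rot (m : ℕ) (δ : ℝ) (x : En (m+1)) :
    brKernel (m+1) δ x = ∫ ξ : En (m+1), (brm (m+1) δ ξ : ℂ) * osc (-(2*π*‖x‖)) (ξ 0) := by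
  set w : En (m+1) := EuclideanSpace.single 0 ‖x‖ with hw
  have hwn : ‖w‖ = ‖x‖ := by simp [hw]
  have hR := Submodule.reflection_sub hwn
  set R := (Submodule.reflection (ℝ ∙ (w - x))ᗮ) with hRdef
  unfold brKernel
  rw [← (R.measurePreserving).integral_comp R.toHomeomorph.measurableEmbedding]
  congr 1; ext ξ
  have h1 : (∑ i, x i * (R ξ) i : ℝ) = ‖x‖ * ξ 0 := by
    have : (∑ i, x i * (R ξ) i : ℝ) = inner ℝ (R ξ) x := by
      simp [PiLp.inner_apply]
    rw [this, ← hR, R.inner_map_map]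
    simp [hw, PiLp.inner_apply]
  rw [h1, exp_osc, R.norm_map]; rfl

def crossI (m : ℕ) (δ : ℝ) : ℝ := ∫ y : Fin m → ℝ, (max (1 - ∑ i, (y i)^2) 0)^δ

lemma cross_int (m : ℕ) (δ s : ℝ) (hs : s ∈ Ioo (-1:ℝ) 1) :
    ∫ y : Fin m → ℝ, (max (1 - s^2 - ∑ i, (y i)^2) 0)^δ = (1 - s^2)^(δ + m/2) * crossI m δ := by
  have hp : 0 < 1 - s^2 := w_pos hs
  set a := √(1 - s^2) with ha
  have ha0 : 0 < a := Real.sqrt_pos.2 hp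
  have ha2 : a^2 = 1 - s^2 := Real.sq_sqrt hp.le
  have h := Measure.integral_comp_smul (volume : Measure (Fin m → ℝ)) (fun y : Fin m → ℝ => (max (1 - s^2 - ∑ i, (y i)^2) 0)^δ) a
  have h2 : ∀ y : Fin m → ℝ, (max (1 - s^2 - ∑ i, ((a • y) i)^2) 0)^δ = (1-s^2)^δ * (max (1 - ∑ i, (y i)^2) 0)^δ := by
    intro y
    rw [← Real.mul_rpow hp.le (by positivity)]
    congr 1
    rw [mul_max_of_nonneg _ _ hp.le]
    simp only [Pi.smul_apply, smul_eq_mul, mul_pow, ← Finset.mul_sum, ha2]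
    ring_nf
  simp only [h2] at h
  rw [integral_const_mul] at h
  rw [abs_of_pos (by positivity), smul_eq_mul, Module.finrank_fin_fun] at h
  have h3 : a^m = (1 - s^2)^((m:ℝ)/2) := by
    rw [ha, Real.sqrt_eq_rpow, ← Real.rpow_natCast, ← Real.rpow_mul hp.le]
    congr 1; ring
  rw [Real.rpow_add hp, ← h3]
  field_simp at h
  unfold crossI
  linarith

lemma brKernel_oI (m : ℕ) (δ : ℝ) (hδ : 0 < δ) (x : En (m+1)) :
    brKernel (m+1) δ x = (crossI m δ : ℂ) * oI (δ + m/2) (-(2*π*‖x‖)) := by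
  rw [brKernel_rot]
  set ω := -(2*π*‖x‖)
  set G : En (m+1) → ℂ := fun ξ => (brm (m+1) δ ξ : ℂ) * osc ω (ξ 0) with hG
  have hGi : Integrable G := by
    have : Continuous G := by
      have h1 := brm_cont (m+1) δ hδ
      have h2 := osc_cont ω
      fun_prop
    refine this.integrable_of_hasCompactSupport ?_
    apply HasCompactSupport.intro (isCompact_closedBall (0 : En (m+1)) 1)
    intro ξ hξ
    simp at hξ
    simp [hG, brm_supp _ δ hδ ξ hξ.le]
  have e1 := (PiLp.volume_preserving_toLp (Fin (m+1)))
  have e2 := (volume_preserving_piFinSuccAbove (fun _ : Fin (m+1) => ℝ) 0).symm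
  have em1 : MeasurableEmbedding (WithLp.toLp 2 : (Fin (m+1) → ℝ) → En (m+1)) :=
    (MeasurableEquiv.toLp 2 (Fin (m+1) → ℝ)).measurableEmbedding
  have em2 := (MeasurableEquiv.piFinSuccAbove (fun _ : Fin (m+1) => ℝ) 0).symm.measurableEmbedding
  have i1 := (e1.integrable_comp_emb em1).2 hGi
  have i2 := (e2.integrable_comp_emb em2).2 i1
  change ∫ ξ, G ξ = _
  rw [← e1.integral_comp em1, ← e2.integral_comp em2 (g := fun x => G (WithLp.toLp 2 x))]
  rw [Measure.volume_eq_prod] at *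
  refine (integral_prod _ i2).trans ?_
  simp only [Function.comp_apply]
  have h3 : ∀ (s : ℝ) (y : Fin m → ℝ), G (WithLp.toLp 2 ((MeasurableEquiv.piFinSuccAbove (fun _ : Fin (m+1) => ℝ) 0).symm (s, y))) =
      (((max (1 - s^2 - ∑ i, (y i)^2) 0)^δ : ℝ) : ℂ) * osc ω s := by
    intro s y
    simp only [hG, brm, EuclideanSpace.norm_sq_eq]
    rw [Fin.sum_univ_succ]
    simp [MeasurableEquiv.piFinSuccAbove, sub_sub]
  simp only [h3]
  have h4 : ∀ s : ℝ, ∫ y : Fin m → ℝ, (((max (1 - s^2 - ∑ i, (y i)^2) 0)^δ : ℝ) : ℂ) * osc ω s =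
     (Ioo (-1:ℝ) 1).indicator (fun s => (crossI m δ : ℂ) * ((((1 - s^2)^(δ + m/2) : ℝ) : ℂ) * osc ω s)) s := by
    intro s
    rw [integral_mul_const, integral_complex_ofReal]
    by_cases hs : s ∈ Ioo (-1:ℝ) 1
    · rw [indicator_of_mem hs, cross_int m δ s hs]; push_cast; ring
    · rw [indicator_of_notMem hs]
      have : 1 ≤ s^2 := by
        by_contra hc
        push Not at hc
        exact hs (by rw [mem_Ioo]; constructor <;> nlinarith)
      have : ∀ y : Fin m → ℝ, (max (1 - s^2 - ∑ i, (y i)^2) 0)^δ = 0 := by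
        intro y
        have : 0 ≤ ∑ i, (y i)^2 := by positivity
        rw [max_eq_right (by linarith), Real.zero_rpow hδ.ne']
      simp [this]
  simp only [h4]
  rw [integral_indicator measurableSet_Ioo, integral_const_mul]
  unfold oI
  rw [intervalIntegral.integral_of_le (by norm_num), integral_Ioc_eq_integral_Ioo]

theorem brKernel_decay (n : ℕ) (hn : 1 ≤ n) (δ : ℝ) (hδ : ((n:ℝ)-1)/2 < δ) :
    ∃ C : ℝ, 0 < C ∧ ∀ x : En n, ‖brKernel n δ x‖ ≤ C * (1 + ‖x‖)^(-(((n:ℝ)+1)/2 + δ)) := by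
  obtain ⟨m, rfl⟩ : ∃ m, n = m + 1 := ⟨n - 1, by omega⟩
  push_cast at *
  have hm : (0:ℝ) ≤ m := by positivity
  have hδ0 : 0 < δ := by linarith
  obtain ⟨C, hC, hd⟩ := dec_all (δ + m/2) (by linarith)
  set l := ((m:ℝ)+1+1)/2 + δ with hl
  have hl0 : 0 < l := by positivity
  set A := ∫ ξ, brm (m+1) δ ξ with hA
  have hA0 : 0 ≤ A := integral_nonneg (brm_nonneg _ _)
  refine ⟨A * 2^l + |crossI m δ| * C * 2^l + 1, by positivity, fun x => ?_⟩
  have hp : 0 < (1 + ‖x‖)^(-l) := by positivity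
  rcases le_total ‖x‖ 1 with h | h
  · have : 1 ≤ 2^l * (1 + ‖x‖)^(-l) := by
      rw [Real.rpow_neg (by positivity), ← div_eq_mul_inv, one_le_div (by positivity)]
      gcongr; linarith
    have h1 := brKernel_bdd (m+1) δ x
    have h2 : 0 ≤ (|crossI m δ| * C * 2^l + 1) * (1 + ‖x‖)^(-l) := by positivity
    nlinarith
  · rw [brKernel_oI m δ hδ0]
    have hω : 2 ≤ |(-(2*π*‖x‖))| := by
      rw [abs_neg, abs_of_nonneg (by positivity)]
      nlinarith [Real.pi_gt_three]
    have h1 := (hd _ hω).1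
    rw [show -(δ + (m:ℝ)/2) - 1 = -l by rw [hl]; ring] at h1
    have h3 : |(-(2*π*‖x‖))|^(-l) ≤ 2^l * (1 + ‖x‖)^(-l) := by
      rw [Real.rpow_neg (by positivity), Real.rpow_neg (by positivity), ← div_eq_mul_inv,
        ← Real.div_rpow (by positivity) (by positivity), ← Real.inv_rpow (by positivity)]
      gcongr
      rw [inv_eq_one_div, div_le_div_iff₀ (by positivity) (by positivity)]
      rw [abs_neg, abs_of_nonneg (by positivity)]
      nlinarith [Real.pi_gt_three]
    rw [norm_mul, Complex.norm_real, Real.norm_eq_abs]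
    calc _ ≤ |crossI m δ| * (C * (2^l * (1 + ‖x‖)^(-l))) := by gcongr; exact h1.trans (by gcongr)
      _ ≤ _ := by
        have : 0 ≤ (A * 2^l + 1) * (1 + ‖x‖)^(-l) := by positivity
        nlinarith



/-- Hardy–Littlewood maximal function (centered). -/
def HL (n : ℕ) (h : En n → ℝ≥0∞) (x : En n) : ℝ≥0∞ :=
  ⨆ (r : ℝ) (_ : 0 < r), (ENNReal.ofReal (r^n))⁻¹ * ∫⁻ y in Metric.ball x r, h y

def vB (n : ℕ) : ℝ≥0∞ := volume (Metric.ball (0 : En n) 1)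

lemma vB_pos (n : ℕ) : vB n ≠ 0 := (Metric.measure_ball_pos volume _ one_pos).ne'
lemma vB_fin (n : ℕ) : vB n ≠ ∞ := measure_ball_lt_top.ne

lemma vol_ball (n : ℕ) (x : En n) {r : ℝ} (hr : 0 < r) :
    volume (Metric.ball x r) = ENNReal.ofReal (r^n) * vB n := by
  rw [Measure.addHaar_ball_of_pos _ _ hr]; simp [vB]

lemma vol_cball (n : ℕ) (x : En n) {r : ℝ} (hr : 0 < r) :
    volume (Metric.closedBall x r) = ENNReal.ofReal (r^n) * vB n := by
  rw [Measure.addHaar_closedBall _ _ hr.le]; simp [vB]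

lemma HL_le (n : ℕ) (h : En n → ℝ≥0∞) (x : En n) {r : ℝ} (hr : 0 < r) :
    ∫⁻ y in Metric.ball x r, h y ≤ ENNReal.ofReal (r^n) * HL n h x := by
  have h1 : (ENNReal.ofReal (r^n))⁻¹ * ∫⁻ y in Metric.ball x r, h y ≤ HL n h x :=
    le_iSup₂_of_le r hr le_rfl
  have hp : ENNReal.ofReal (r^n) ≠ 0 := by simp; positivity
  calc _ = ENNReal.ofReal (r^n) * ((ENNReal.ofReal (r^n))⁻¹ * ∫⁻ y in Metric.ball x r, h y) := by
        rw [← mul_assoc, ENNReal.mul_inv_cancel hp ENNReal.ofReal_ne_top, one_mul]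
    _ ≤ _ := by gcongr

lemma HL_mono (n : ℕ) {h k : En n → ℝ≥0∞} (hk : h ≤ k) (x : En n) : HL n h x ≤ HL n k x := by
  unfold HL
  gcongr
  exact hk _

lemma HL_open (n : ℕ) (h : En n → ℝ≥0∞) (l : ℝ≥0∞) : IsOpen {x | l < HL n h x} := by
  rw [Metric.isOpen_iff]
  intro x hx
  simp only [mem_ofPred_eq, HL, lt_iSup_iff] at hx
  obtain ⟨r, hr, hlt⟩ := hx
  have hp : ENNReal.ofReal (r^n) ≠ 0 := by simp; positivity
  have hU : Metric.ball x r = ⋃ k : ℕ, Metric.ball x (r - (1/((k:ℝ)+1))) := by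
    ext y
    simp only [Metric.mem_ball, mem_iUnion]
    constructor
    · intro hy
      obtain ⟨k, hk⟩ := exists_nat_one_div_lt (sub_pos.2 hy)
      exact ⟨k, by linarith⟩
    · rintro ⟨k, hk⟩
      have : 0 < 1/((k:ℝ)+1) := by positivity
      linarith
  have hmono : Monotone (fun k : ℕ => Metric.ball x (r - (1/((k:ℝ)+1)))) := by
    intro a b hab
    apply Metric.ball_subset_ball
    have := one_div_le_one_div_of_le (by positivity : 0 < (a:ℝ)+1) (by gcongr : (a:ℝ)+1 ≤ (b:ℝ)+1)
    linarith
  have hlim : Filter.Tendsto (fun k : ℕ => (ENNReal.ofReal (r^n))⁻¹ * ∫⁻ y in Metric.ball x (r - (1/((k:ℝ)+1))), h y)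
      Filter.atTop (nhds ((ENNReal.ofReal (r^n))⁻¹ * ∫⁻ y in Metric.ball x r, h y)) := by
    apply ENNReal.Tendsto.const_mul
    · have := tendsto_measure_iUnion_atTop (μ := volume.withDensity h) hmono
      rw [← hU] at this
      simp only [Function.comp_def] at this
      simpa only [withDensity_apply _ Metric.isOpen_ball.measurableSet] using this
    · right; simpa using hp
  obtain ⟨k, hk⟩ := (hlim.eventually (lt_mem_nhds hlt)).exists
  refine ⟨1/((k:ℝ)+1), by positivity, fun y hy => ?_⟩
  simp only [mem_ofPred_eq]
  refine hk.trans_le (le_iSup₂_of_le r hr ?_)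
  gcongr
  apply Metric.ball_subset_ball'
  rw [dist_comm]
  rw [Metric.mem_ball] at hy
  linarith

lemma HL_meas (n : ℕ) (h : En n → ℝ≥0∞) : Measurable (HL n h) :=
  measurable_of_Ioi fun l => (HL_open n h l).measurableSet

lemma HL_weak (n : ℕ) (hn : 1 ≤ n) (h : En n → ℝ≥0∞) (l : ℝ≥0∞) (hl : l ≠ 0) (hl' : l ≠ ∞) :
    l * volume {x | l < HL n h x} ≤ ENNReal.ofReal (5^n) * vB n * ∫⁻ y, h y := by
  by_cases hI : ∫⁻ y, h y = ∞
  · rw [hI, ENNReal.mul_top]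
    · exact le_top
    · simp [vB_pos]
  have key : ∀ x : {x | l < HL n h x}, ∃ r : ℝ, 0 < r ∧ l * ENNReal.ofReal (r^n) ≤ ∫⁻ y in Metric.ball (x : En n) r, h y := by
    rintro ⟨x, hx⟩
    simp only [mem_ofPred_eq, HL, lt_iSup_iff] at hx
    obtain ⟨r, hr, hlt⟩ := hx
    refine ⟨r, hr, ?_⟩
    have hp : ENNReal.ofReal (r^n) ≠ 0 := by simp; positivity
    calc _ ≤ (ENNReal.ofReal (r^n))⁻¹ * (∫⁻ y in Metric.ball x r, h y) * ENNReal.ofReal (r^n) := by gcongr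
      _ = _ := by rw [mul_comm, ← mul_assoc, ENNReal.mul_inv_cancel hp ENNReal.ofReal_ne_top, one_mul]
  choose r hr hrI using key
  have hbd : ∃ R : ℝ, ∀ x, r x ≤ R := by
    refine ⟨max 1 ((∫⁻ y, h y) / l).toReal, fun x => ?_⟩
    by_contra hc
    push Not at hc
    rw [max_lt_iff] at hc
    have h1 : ENNReal.ofReal ((r x)^n) ≤ (∫⁻ y, h y) / l := by
      rw [ENNReal.le_div_iff_mul_le (Or.inl hl) (Or.inl hl'), mul_comm]
      exact (hrI x).trans (setLIntegral_le_lintegral _ _)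
    have h2 := (ENNReal.ofReal_le_iff_le_toReal (ENNReal.div_lt_top hI hl).ne).1 h1
    have h3 : r x ≤ (r x)^n := le_self_pow₀ hc.1.le (by omega)
    linarith
  obtain ⟨R, hR⟩ := hbd
  obtain ⟨u, -, hdisj, hcov⟩ := Vitali.exists_disjoint_subfamily_covering_enlargement_closedBall
    (univ : Set {x | l < HL n h x}) (fun x => (x : En n)) r R (fun a _ => hR a) 5 (by norm_num)
  have hdb : u.PairwiseDisjoint (fun a => Metric.ball (a : En n) (r a)) :=
    hdisj.mono (fun a => Metric.ball_subset_closedBall)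
  have hcount : u.Countable := by
    apply hdb.countable_of_isOpen (fun a _ => Metric.isOpen_ball)
    intro a _
    exact ⟨a, Metric.mem_ball_self (hr a)⟩
  have hsub : {x | l < HL n h x} ⊆ ⋃ a ∈ u, Metric.closedBall (a : En n) (5 * r a) := by
    intro x hx
    obtain ⟨b, hb, hsubb⟩ := hcov ⟨x, hx⟩ (mem_univ _)
    simp only [mem_iUnion]
    exact ⟨b, hb, hsubb (Metric.mem_closedBall_self (hr _).le)⟩
  have : Countable u := hcount.to_subtype
  calc l * volume {x | l < HL n h x} ≤ l * ∑' a : u, volume (Metric.closedBall ((a : {x | l < HL n h x}) : En n) (5 * r a)) := by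
        gcongr
        refine (measure_mono hsub).trans ?_
        exact measure_biUnion_le volume hcount _
    _ = ENNReal.ofReal (5^n) * vB n * ∑' a : u, l * ENNReal.ofReal ((r a)^n) := by
        rw [← ENNReal.tsum_mul_left, ← ENNReal.tsum_mul_left]
        congr 1; ext a
        rw [vol_cball _ _ (by have := hr a; positivity), mul_pow, ENNReal.ofReal_mul (by positivity)]
        ring
    _ ≤ ENNReal.ofReal (5^n) * vB n * ∑' a : u, ∫⁻ y in Metric.ball ((a : {x | l < HL n h x}) : En n) (r a), h y := by
        gcongr with a
        exact hrI a
    _ = ENNReal.ofReal (5^n) * vB n * ∫⁻ y in ⋃ a ∈ u, Metric.ball (a : En n) (r a), h y := by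
        rw [lintegral_biUnion hcount (fun a _ => Metric.isOpen_ball.measurableSet) hdb]
    _ ≤ _ := by gcongr; exact Measure.restrict_le_self

lemma layer_lower (a : ℝ≥0∞) :
    a^2 ≤ 4 * ∫⁻ l in Ioi (0:ℝ), ENNReal.ofReal l * {l : ℝ | ENNReal.ofReal l < a}.indicator 1 l := by
  have gen : ∀ b : ℝ, 0 < b → ENNReal.ofReal b ≤ a → ENNReal.ofReal b ^ 2 ≤
      4 * ∫⁻ l in Ioi (0:ℝ), ENNReal.ofReal l * {l : ℝ | ENNReal.ofReal l < a}.indicator 1 l := by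
    intro b hb hba
    have : ∫⁻ l in Ioo (b/2) b, ENNReal.ofReal (b/2) ≤ ∫⁻ l in Ioi (0:ℝ), ENNReal.ofReal l * {l : ℝ | ENNReal.ofReal l < a}.indicator 1 l := by
      calc _ ≤ ∫⁻ l in Ioo (b/2) b, ENNReal.ofReal l * {l : ℝ | ENNReal.ofReal l < a}.indicator 1 l := by
            apply setLIntegral_mono' measurableSet_Ioo
            intro l hl
            have hm : l ∈ {l : ℝ | ENNReal.ofReal l < a} := by
              refine lt_of_lt_of_le ?_ hba
              exact (ENNReal.ofReal_lt_ofReal_iff hb).2 hl.2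
            rw [indicator_of_mem hm]
            simp only [Pi.one_apply, mul_one]
            exact ENNReal.ofReal_le_ofReal hl.1.le
        _ ≤ _ := lintegral_mono_set (fun l hl => by
            have := hl.1
            simp only [mem_Ioi]; linarith)
    calc ENNReal.ofReal b ^ 2 = 4 * ∫⁻ l in Ioo (b/2) b, ENNReal.ofReal (b/2) := by
          rw [setLIntegral_const, Real.volume_Ioo, ← ENNReal.ofReal_mul (by positivity), ← ENNReal.ofReal_pow hb.le]
          rw [show (4:ℝ≥0∞) = ENNReal.ofReal 4 by simp, ← ENNReal.ofReal_mul (by positivity)]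
          congr 1; ring
      _ ≤ _ := by gcongr
  by_cases ha : a = ∞
  · rw [ENNReal.eq_top_of_forall_nnreal_le (x := 4 * ∫⁻ l in Ioi (0:ℝ), ENNReal.ofReal l * {l : ℝ | ENNReal.ofReal l < a}.indicator 1 l)]
    · exact le_top
    · intro c
      refine le_trans ?_ (gen (c+1) (by positivity) (by rw [ha]; exact le_top))
      rw [← ENNReal.ofReal_pow (by positivity), ← ENNReal.ofReal_coe_nnreal]
      apply ENNReal.ofReal_le_ofReal
      have : (0:ℝ) ≤ c := c.2
      nlinarith
  · by_cases h0 : a = 0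
    · simp [h0]
    · have := gen a.toReal (ENNReal.toReal_pos h0 ha) (by rw [ENNReal.ofReal_toReal ha])
      rwa [ENNReal.ofReal_toReal ha] at this

lemma layer_upper (a : ℝ≥0∞) (c : ℝ) (hc : 0 < c) :
    ∫⁻ l in Ioi (0:ℝ), {l : ℝ | ENNReal.ofReal (c*l) < a}.indicator 1 l ≤ ENNReal.ofReal c⁻¹ * a := by
  by_cases ha : a = ∞
  · rw [ha, ENNReal.mul_top (by simpa using hc)]; exact le_top
  have hm : MeasurableSet {l : ℝ | ENNReal.ofReal (c*l) < a} := by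
    apply measurableSet_lt <;> fun_prop
  rw [lintegral_indicator_one hm, Measure.restrict_apply hm]
  calc _ ≤ volume (Ioo (0:ℝ) (c⁻¹ * a.toReal)) := by
        apply measure_mono
        rintro l ⟨h1, h2⟩
        simp only [mem_ofPred_eq] at h1
        rw [ENNReal.ofReal_lt_iff_lt_toReal (by have := mem_Ioi.1 h2; positivity) ha] at h1
        refine ⟨h2, ?_⟩
        rw [inv_mul_eq_div, lt_div_iff₀ hc]; linarith
    _ = _ := by
        rw [Real.volume_Ioo, sub_zero, ENNReal.ofReal_mul (by positivity), ENNReal.ofReal_toReal ha]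



lemma HL_add_const (n : ℕ) (h k : En n → ℝ≥0∞) (hk : Measurable k) (c : ℝ≥0∞) (hle : ∀ x, h x ≤ k x + c) (x : En n) :
    HL n h x ≤ HL n k x + vB n * c := by
  refine iSup₂_le fun r hr => ?_
  have hp : ENNReal.ofReal (r^n) ≠ 0 := by simp; positivity
  calc _ ≤ (ENNReal.ofReal (r^n))⁻¹ * ∫⁻ y in Metric.ball x r, (k y + c) := by gcongr; exact hle _
    _ = (ENNReal.ofReal (r^n))⁻¹ * (∫⁻ y in Metric.ball x r, k y) + vB n * c := by
      rw [lintegral_add_left hk, mul_add, setLIntegral_const, vol_ball n x hr]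
      congr 1
      rw [mul_comm c, mul_assoc, ← mul_assoc, ENNReal.inv_mul_cancel hp ENNReal.ofReal_ne_top, one_mul]
    _ ≤ _ := by gcongr; exact le_iSup₂_of_le r hr le_rfl

/-- L² bound for HL. -/
lemma HL_L2 (n : ℕ) (hn : 1 ≤ n) : ∃ C : ℝ≥0∞, C ≠ ∞ ∧ ∀ h : En n → ℝ≥0∞, Measurable h →
    ∫⁻ x, (HL n h x)^2 ≤ C * ∫⁻ x, (h x)^2 := by
  set v : ℝ := (vB n).toReal with hv
  have hv0 : 0 < v := ENNReal.toReal_pos (vB_pos n) (vB_fin n)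
  have hvE : vB n = ENNReal.ofReal v := (ENNReal.ofReal_toReal (vB_fin n)).symm
  set c : ℝ := (2*v)⁻¹ with hc
  have hc0 : 0 < c := by positivity
  set K := ENNReal.ofReal (5^n) * vB n with hK
  have hKf : K ≠ ∞ := ENNReal.mul_ne_top ENNReal.ofReal_ne_top (vB_fin n)
  refine ⟨4 * (2 * K * ENNReal.ofReal c⁻¹), ?_, fun h hm => ?_⟩
  · exact ENNReal.mul_ne_top (by simp) (ENNReal.mul_ne_top (ENNReal.mul_ne_top (by simp) hKf) ENNReal.ofReal_ne_top)
  have hHm := HL_meas n h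
  have hwk : ∀ l : ℝ, 0 < l → ENNReal.ofReal l * volume {x | ENNReal.ofReal l < HL n h x} ≤
      2 * K * ∫⁻ x, h x * {l : ℝ | ENNReal.ofReal (c*l) < h x}.indicator 1 l := by
    intro l hl
    set S := {x | ENNReal.ofReal (c*l) < h x} with hS
    have hSm : MeasurableSet S := measurableSet_lt measurable_const hm
    set k : En n → ℝ≥0∞ := S.indicator h with hk
    have hkm : Measurable k := hm.indicator hSm
    have hle : ∀ x, h x ≤ k x + ENNReal.ofReal (c*l) := by
      intro x
      by_cases hx : x ∈ S
      · rw [hk, indicator_of_mem hx]; exact le_self_add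
      · rw [hk, indicator_of_notMem hx, zero_add]; exact not_lt.1 hx
    have hsub : {x | ENNReal.ofReal l < HL n h x} ⊆ {x | ENNReal.ofReal (l/2) < HL n k x} := by
      intro x hx
      have h1 := lt_of_lt_of_le hx (HL_add_const n h k hkm _ hle x)
      rw [hvE, ← ENNReal.ofReal_mul hv0.le, show v * (c*l) = l/2 by rw [hc]; field_simp] at h1
      by_contra hcon
      simp only [mem_ofPred_eq, not_lt] at hcon
      have : HL n k x + ENNReal.ofReal (l/2) ≤ ENNReal.ofReal l := by
        calc _ ≤ ENNReal.ofReal (l/2) + ENNReal.ofReal (l/2) := by gcongr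
          _ = _ := by rw [← ENNReal.ofReal_add (by positivity) (by positivity)]; congr 1; ring
      exact absurd h1 (not_lt.2 this)
    have hw := HL_weak n hn k (ENNReal.ofReal (l/2)) (by simpa using hl) ENNReal.ofReal_ne_top
    calc _ ≤ ENNReal.ofReal l * volume {x | ENNReal.ofReal (l/2) < HL n k x} := by gcongr
      _ = 2 * (ENNReal.ofReal (l/2) * volume {x | ENNReal.ofReal (l/2) < HL n k x}) := by
        rw [← mul_assoc]; congr 1
        rw [show (2:ℝ≥0∞) = ENNReal.ofReal 2 by simp, ← ENNReal.ofReal_mul (by positivity)]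
        congr 1; ring
      _ ≤ 2 * (K * ∫⁻ y, k y) := by gcongr
      _ = 2 * K * ∫⁻ x, h x * {l : ℝ | ENNReal.ofReal (c*l) < h x}.indicator 1 l := by
        rw [← mul_assoc]; congr 1; apply lintegral_congr; intro x
        simp only [hk, indicator, hS, mem_ofPred_eq, Pi.one_apply]
        split_ifs <;> simp
  have m1 : Measurable (fun z : En n × ℝ => ENNReal.ofReal z.2 * {l : ℝ | ENNReal.ofReal l < HL n h z.1}.indicator (1 : ℝ → ℝ≥0∞) z.2) := by
    have : MeasurableSet {z : En n × ℝ | ENNReal.ofReal z.2 < HL n h z.1} :=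
      measurableSet_lt (by fun_prop) (by fun_prop)
    have h2 : Measurable (fun z : En n × ℝ => {z : En n × ℝ | ENNReal.ofReal z.2 < HL n h z.1}.indicator (1 : En n × ℝ → ℝ≥0∞) z) :=
      measurable_one.indicator this
    exact (by fun_prop : Measurable (fun z : En n × ℝ => ENNReal.ofReal z.2)).mul h2
  have m2 : Measurable (fun z : ℝ × En n => h z.2 * {l : ℝ | ENNReal.ofReal (c*l) < h z.2}.indicator (1 : ℝ → ℝ≥0∞) z.1) := by
    have : MeasurableSet {z : ℝ × En n | ENNReal.ofReal (c * z.1) < h z.2} :=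
      measurableSet_lt (by fun_prop) (by fun_prop)
    have h2 : Measurable (fun z : ℝ × En n => {z : ℝ × En n | ENNReal.ofReal (c * z.1) < h z.2}.indicator (1 : ℝ × En n → ℝ≥0∞) z) :=
      measurable_one.indicator this
    exact (by fun_prop : Measurable (fun z : ℝ × En n => h z.2)).mul h2
  calc ∫⁻ x, (HL n h x)^2 ≤ ∫⁻ x, 4 * ∫⁻ l in Ioi (0:ℝ), ENNReal.ofReal l * {l : ℝ | ENNReal.ofReal l < HL n h x}.indicator 1 l :=
        lintegral_mono fun x => layer_lower _
    _ = 4 * ∫⁻ l in Ioi (0:ℝ), ∫⁻ x, ENNReal.ofReal l * {l : ℝ | ENNReal.ofReal l < HL n h x}.indicator 1 l := by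
        rw [lintegral_const_mul' _ _ (by simp), lintegral_lintegral_swap]
        exact m1.aemeasurable
    _ = 4 * ∫⁻ l in Ioi (0:ℝ), ENNReal.ofReal l * volume {x | ENNReal.ofReal l < HL n h x} := by
        congr 2; ext l
        rw [lintegral_const_mul' _ _ ENNReal.ofReal_ne_top]
        congr 1
        rw [← lintegral_indicator_one (measurableSet_lt measurable_const hHm)]
        rfl
    _ ≤ 4 * ∫⁻ l in Ioi (0:ℝ), 2 * K * ∫⁻ x, h x * {l : ℝ | ENNReal.ofReal (c*l) < h x}.indicator 1 l := by
        gcongr 4 * ?_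
        apply setLIntegral_mono' measurableSet_Ioi
        intro l hl
        exact hwk l hl
    _ = 4 * (2 * K * ∫⁻ x, h x * ∫⁻ l in Ioi (0:ℝ), {l : ℝ | ENNReal.ofReal (c*l) < h x}.indicator 1 l) := by
        rw [lintegral_const_mul' _ _ (ENNReal.mul_ne_top (by simp) hKf), lintegral_lintegral_swap m2.aemeasurable]
        congr 3; ext x
        rw [lintegral_const_mul]
        have : MeasurableSet {l : ℝ | ENNReal.ofReal (c * l) < h x} :=
          measurableSet_lt (by fun_prop) (by fun_prop)
        exact measurable_one.indicator this
    _ ≤ 4 * (2 * K * ∫⁻ x, ENNReal.ofReal c⁻¹ * (h x)^2) := by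
        gcongr 4 * (2 * K * ?_)
        apply lintegral_mono; intro x
        calc _ ≤ h x * (ENNReal.ofReal c⁻¹ * h x) := by exact mul_le_mul_right (layer_upper _ _ hc0) _
          _ = _ := by ring
    _ = _ := by
        rw [lintegral_const_mul' _ _ ENNReal.ofReal_ne_top]; ring

lemma CS_sq {α : Type*} [MeasurableSpace α] (μ : Measure α) (h : α → ℝ≥0∞) (hm : Measurable h) :
    (∫⁻ x, h x ∂μ)^2 ≤ μ univ * ∫⁻ x, (h x)^2 ∂μ := by
  have := ENNReal.lintegral_mul_le_Lp_mul_Lq μ (Real.HolderConjugate.two_two) hm.aemeasurable (measurable_one (β := α) (α := ℝ≥0∞)).aemeasurable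
  simp only [Pi.mul_apply, Pi.one_apply, mul_one, ENNReal.one_rpow, lintegral_const, one_mul] at this
  calc _ ≤ ((∫⁻ x, h x ^ (2:ℝ) ∂μ) ^ (1/2:ℝ) * (μ univ)^(1/2:ℝ))^2 := by gcongr
    _ = _ := by
      rw [mul_pow, ← ENNReal.rpow_natCast, ← ENNReal.rpow_mul, ← ENNReal.rpow_natCast, ← ENNReal.rpow_mul]
      simp [mul_comm]

/-- Morrey bound for HL. -/
lemma HL_morrey (n : ℕ) (hn : 1 ≤ n) (σ : ℝ) (hσ : 0 ≤ σ) (hσn : σ ≤ n) : ∃ C : ℝ≥0∞, C ≠ ∞ ∧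
    ∀ h : En n → ℝ≥0∞, Measurable h → ∀ T : ℝ≥0∞,
    (∀ x R, 0 < R → ∫⁻ y in Metric.ball x R, (h y)^2 ≤ T * ENNReal.ofReal (R^σ)) →
    ∀ x R, 0 < R → ∫⁻ y in Metric.ball x R, (HL n h y)^2 ≤ C * T * ENNReal.ofReal (R^σ) := by
  obtain ⟨C, hC, hL2⟩ := HL_L2 n hn
  refine ⟨2 * (C * ENNReal.ofReal (2^σ) + vB n * vB n), ?_, fun h hm T hT x R hR => ?_⟩
  · exact ENNReal.mul_ne_top (by simp) (ENNReal.add_ne_top.2 ⟨ENNReal.mul_ne_top hC ENNReal.ofReal_ne_top, ENNReal.mul_ne_top (vB_fin n) (vB_fin n)⟩)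
  set k := (Metric.ball x (2*R)).indicator h with hk
  have hkm : Measurable k := hm.indicator Metric.isOpen_ball.measurableSet
  set D := vB n * T * ENNReal.ofReal (R^(σ - n)) with hD
  have pt : ∀ y ∈ Metric.ball x R, (HL n h y)^2 ≤ 2 * ((HL n k y)^2 + D) := by
    intro y hy
    have hsup : HL n h y ≤ max (HL n k y) (D^(1/2:ℝ)) := by
      refine iSup₂_le fun r hr => ?_
      have hp : ENNReal.ofReal (r^n) ≠ 0 := by simp; positivity
      rcases le_total r R with hrR | hrR
      · refine le_max_of_le_left (le_iSup₂_of_le r hr ?_)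
        gcongr 1
        apply le_of_eq
        apply setLIntegral_congr_fun Metric.isOpen_ball.measurableSet
        intro z hz
        have : z ∈ Metric.ball x (2*R) := by
          rw [Metric.mem_ball] at *
          have := dist_triangle z y x
          linarith
        simp [hk, indicator_of_mem this]
      · refine le_max_of_le_right ?_
        have h1 : ((ENNReal.ofReal (r^n))⁻¹ * ∫⁻ z in Metric.ball y r, h z)^(2:ℝ) ≤ D := by
          rw [show (2:ℝ) = ((2:ℕ):ℝ) by norm_num, ENNReal.rpow_natCast, mul_pow]
          calc _ ≤ (ENNReal.ofReal (r^n))⁻¹^2 * ((ENNReal.ofReal (r^n) * vB n) * (T * ENNReal.ofReal (r^σ))) := by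
                gcongr
                refine (CS_sq _ h hm).trans ?_
                rw [Measure.restrict_apply_univ, vol_ball n y hr]
                gcongr
                exact hT y r hr
            _ = vB n * T * ((ENNReal.ofReal (r^n))⁻¹ * ((ENNReal.ofReal (r^n))⁻¹ * ENNReal.ofReal (r^n)) * ENNReal.ofReal (r^σ)) := by ring
            _ = vB n * T * ENNReal.ofReal (r^(σ-n)) := by
                rw [ENNReal.inv_mul_cancel hp ENNReal.ofReal_ne_top, mul_one, ← ENNReal.ofReal_inv_of_pos (by positivity), ← ENNReal.ofReal_mul (by positivity)]
                congr 2
                rw [Real.rpow_sub hr, Real.rpow_natCast]; field_simp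
            _ ≤ D := by
                rw [hD]
                gcongr vB n * T * ENNReal.ofReal ?_
                exact Real.rpow_le_rpow_of_nonpos hR hrR (by linarith)
        calc _ = (((ENNReal.ofReal (r^n))⁻¹ * ∫⁻ z in Metric.ball y r, h z)^(2:ℝ))^(1/2:ℝ) := by
              rw [← ENNReal.rpow_mul]; norm_num
          _ ≤ _ := by gcongr
    have hD2 : (D^(1/2:ℝ))^2 = D := by
      rw [← ENNReal.rpow_natCast, ← ENNReal.rpow_mul]; norm_num
    calc _ ≤ (max (HL n k y) (D^(1/2:ℝ)))^2 := by gcongr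
      _ ≤ (HL n k y)^2 + D := by
        rcases max_cases (HL n k y) (D^(1/2:ℝ)) with h | h
        · rw [h.1]; exact le_self_add
        · rw [h.1, hD2]; exact le_add_self
      _ ≤ _ := by rw [two_mul]; exact le_self_add
  calc ∫⁻ y in Metric.ball x R, (HL n h y)^2 ≤ ∫⁻ y in Metric.ball x R, 2 * ((HL n k y)^2 + D) :=
        setLIntegral_mono' Metric.isOpen_ball.measurableSet pt
    _ = 2 * ((∫⁻ y in Metric.ball x R, (HL n k y)^2) + D * (ENNReal.ofReal (R^n) * vB n)) := by
        rw [lintegral_const_mul' _ _ (by simp), lintegral_add_right _ measurable_const, setLIntegral_const, vol_ball n x hR]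
    _ ≤ 2 * (C * (T * ENNReal.ofReal ((2*R)^σ)) + D * (ENNReal.ofReal (R^n) * vB n)) := by
        gcongr
        refine (setLIntegral_le_lintegral _ _).trans ((hL2 k hkm).trans ?_)
        gcongr
        refine le_trans (le_of_eq ?_) (hT x (2*R) (by positivity))
        rw [← lintegral_indicator Metric.isOpen_ball.measurableSet]
        congr 1; ext y
        simp only [hk, indicator]; split_ifs <;> simp
    _ = _ := by
        have : ENNReal.ofReal (R^σ) = ENNReal.ofReal (R^(σ-n)) * ENNReal.ofReal (R^n) := by
          rw [← ENNReal.ofReal_mul (by positivity), ← Real.rpow_natCast, ← Real.rpow_add hR]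
          congr 2; ring
        rw [hD, Real.mul_rpow (by norm_num) hR.le, ENNReal.ofReal_mul (by positivity), this]
        ring

/-- dyadic majorant -/
lemma dyadic_maj (N : ℕ) (s : ℝ) (hs : 0 ≤ s) :
    ENNReal.ofReal (((1+s)^N)⁻¹) ≤ ∑' k : ℕ, ENNReal.ofReal (2^N * ((2^k)^N)⁻¹) * {s : ℝ | s < 2^k}.indicator 1 s := by
  have hex : ∃ k : ℕ, s < 2^k := pow_unbounded_of_one_lt s (by norm_num)
  classical
  set k := Nat.find hex with hk
  have hks : s < 2^k := Nat.find_spec hex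
  refine le_trans ?_ (ENNReal.le_tsum k)
  rw [indicator_of_mem (by exact hks), Pi.one_apply, mul_one]
  apply ENNReal.ofReal_le_ofReal
  rw [← div_eq_mul_inv, inv_eq_one_div, div_le_div_iff₀ (by positivity) (by positivity), one_mul, ← mul_pow]
  gcongr
  rcases Nat.eq_zero_or_pos k with h0 | h0
  · rw [h0]; simp; linarith
  · have := Nat.find_min hex (m := k - 1) (by omega)
    push Not at this
    have h2 : (2:ℝ)^k = 2 * 2^(k-1) := by rw [← pow_succ']; congr 1; omega
    rw [h2]; linarith

lemma HL_kernel (n : ℕ) (h : En n → ℝ≥0∞) (hm : Measurable h) (x : En n) (t : ℝ) (ht : 0 < t) :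
    ∫⁻ y, ENNReal.ofReal ((t^n)⁻¹ * ((1 + ‖x - y‖/t)^(n+1))⁻¹) * h y ≤ ENNReal.ofReal (2^(n+2)) * HL n h x := by
  have hset : ∀ k : ℕ, ∀ y, {s : ℝ | s < 2^k}.indicator (1:ℝ → ℝ≥0∞) (‖x-y‖/t) = (Metric.ball x (2^k*t)).indicator 1 y := by
    intro k y
    simp only [indicator, mem_ofPred_eq, Metric.mem_ball, div_lt_iff₀ ht, dist_comm y x, dist_eq_norm, Pi.one_apply]
  calc _ ≤ ∫⁻ y, ∑' k : ℕ, ENNReal.ofReal ((t^n)⁻¹ * (2^(n+1) * ((2^k)^(n+1))⁻¹)) * (Metric.ball x (2^k*t)).indicator h y := by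
        apply lintegral_mono
        intro y
        simp only
        rw [ENNReal.ofReal_mul (by positivity)]
        calc _ ≤ ENNReal.ofReal (t^n)⁻¹ * (∑' k : ℕ, ENNReal.ofReal (2^(n+1) * ((2^k)^(n+1))⁻¹) * {s : ℝ | s < 2^k}.indicator 1 (‖x-y‖/t)) * h y := by
              gcongr; exact dyadic_maj _ _ (by positivity)
          _ = _ := by
              rw [← ENNReal.tsum_mul_left, ← ENNReal.tsum_mul_right]
              congr 1; ext k
              rw [hset, ENNReal.ofReal_mul (p := (t^n)⁻¹) (by positivity)]
              simp only [indicator]; split_ifs <;> simp [mul_assoc]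
    _ = ∑' k : ℕ, ENNReal.ofReal ((t^n)⁻¹ * (2^(n+1) * ((2^k)^(n+1))⁻¹)) * ∫⁻ y in Metric.ball x (2^k*t), h y := by
        rw [lintegral_tsum]
        · congr 1; ext k
          rw [lintegral_const_mul' _ _ ENNReal.ofReal_ne_top, lintegral_indicator Metric.isOpen_ball.measurableSet]
        · intro k
          exact (measurable_const.mul (hm.indicator Metric.isOpen_ball.measurableSet)).aemeasurable
    _ ≤ ∑' k : ℕ, ENNReal.ofReal ((t^n)⁻¹ * (2^(n+1) * ((2^k)^(n+1))⁻¹)) * (ENNReal.ofReal ((2^k*t)^n) * HL n h x) := by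
        gcongr with k
        exact HL_le n h x (by positivity)
    _ = ∑' k : ℕ, ENNReal.ofReal (2^(n+1)) * ENNReal.ofReal ((1/2)^k) * HL n h x := by
        congr 1; ext k
        rw [← mul_assoc, ← ENNReal.ofReal_mul (by positivity), ← ENNReal.ofReal_mul (by positivity)]
        congr 2
        field_simp
        rw [mul_pow, pow_succ, one_div, inv_pow]
        field_simp
    _ = _ := by
        rw [ENNReal.tsum_mul_right, ENNReal.tsum_mul_left, ← ENNReal.ofReal_tsum_of_nonneg (by intro k; positivity) (summable_geometric_of_lt_one (by norm_num) (by norm_num)),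
          tsum_geometric_of_lt_one (by norm_num) (by norm_num), ← ENNReal.ofReal_mul (by positivity)]
        congr 2
        rw [pow_succ (2:ℝ) (n+1)]; norm_num

/-- Far weight against a Morrey-bounded measure. -/
lemma far_weight (n : ℕ) (σ : ℝ) (hσ : 0 ≤ σ) (hσn : σ < n) : ∃ C : ℝ≥0∞, C ≠ ∞ ∧
    ∀ h : En n → ℝ≥0∞, Measurable h → ∀ T : ℝ≥0∞,
    (∀ x R, 0 < R → ∫⁻ y in Metric.ball x R, h y ≤ T * ENNReal.ofReal (R^σ)) →
    ∀ x R, 0 < R → ∫⁻ y, ENNReal.ofReal (((R + ‖y - x‖)^n)⁻¹) * h y ≤ C * T * ENNReal.ofReal (R^(σ - n)) := by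
  set a : ℝ := 2^(σ - n) with ha
  have ha1 : a < 1 := Real.rpow_lt_one_of_one_lt_of_neg (by norm_num) (by linarith)
  have ha0 : 0 < a := by positivity
  refine ⟨ENNReal.ofReal (2^n * (1 - a)⁻¹), ENNReal.ofReal_ne_top, fun h hm T hT x t ht => ?_⟩
  have hset : ∀ k : ℕ, ∀ y, {s : ℝ | s < 2^k}.indicator (1:ℝ → ℝ≥0∞) (‖y-x‖/t) = (Metric.ball x (2^k*t)).indicator 1 y := by
    intro k y
    simp only [indicator, mem_ofPred_eq, Metric.mem_ball, div_lt_iff₀ ht, dist_eq_norm, Pi.one_apply]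
  calc _ ≤ ∫⁻ y, ∑' k : ℕ, ENNReal.ofReal ((t^n)⁻¹ * (2^n * ((2^k)^n)⁻¹)) * (Metric.ball x (2^k*t)).indicator h y := by
        apply lintegral_mono
        intro y
        simp only
        rw [show ((t + ‖y - x‖)^n)⁻¹ = (t^n)⁻¹ * ((1 + ‖y-x‖/t)^n)⁻¹ by
          rw [← mul_inv, ← mul_pow]; congr 2; field_simp]
        rw [ENNReal.ofReal_mul (by positivity)]
        calc _ ≤ ENNReal.ofReal (t^n)⁻¹ * (∑' k : ℕ, ENNReal.ofReal (2^n * ((2^k)^n)⁻¹) * {s : ℝ | s < 2^k}.indicator 1 (‖y-x‖/t)) * h y := by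
              gcongr; exact dyadic_maj _ _ (by positivity)
          _ = _ := by
              rw [← ENNReal.tsum_mul_left, ← ENNReal.tsum_mul_right]
              congr 1; ext k
              rw [hset, ENNReal.ofReal_mul (p := (t^n)⁻¹) (by positivity)]
              simp only [indicator]; split_ifs <;> simp [mul_assoc]
    _ = ∑' k : ℕ, ENNReal.ofReal ((t^n)⁻¹ * (2^n * ((2^k)^n)⁻¹)) * ∫⁻ y in Metric.ball x (2^k*t), h y := by
        rw [lintegral_tsum]
        · congr 1; ext k
          rw [lintegral_const_mul' _ _ ENNReal.ofReal_ne_top, lintegral_indicator Metric.isOpen_ball.measurableSet]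
        · intro k
          exact (measurable_const.mul (hm.indicator Metric.isOpen_ball.measurableSet)).aemeasurable
    _ ≤ ∑' k : ℕ, ENNReal.ofReal ((t^n)⁻¹ * (2^n * ((2^k)^n)⁻¹)) * (T * ENNReal.ofReal ((2^k*t)^σ)) := by
        gcongr with k
        exact hT x _ (by positivity)
    _ = ∑' k : ℕ, ENNReal.ofReal (2^n) * ENNReal.ofReal (a^k) * (T * ENNReal.ofReal (t^(σ-n))) := by
        congr 1; ext k
        rw [mul_left_comm, ← ENNReal.ofReal_mul (by positivity), mul_left_comm _ T, ← ENNReal.ofReal_mul (by positivity),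
          ← ENNReal.ofReal_mul (by positivity)]
        congr 2
        rw [Real.mul_rpow (by positivity) ht.le, Real.rpow_sub ht, ha, ← Real.rpow_natCast (2^(σ-n)), ← Real.rpow_mul (by norm_num),
          mul_comm (σ - n), Real.rpow_mul (by norm_num), Real.rpow_sub (by positivity), Real.rpow_natCast, Real.rpow_natCast, Real.rpow_natCast]
        field_simp
    _ = _ := by
        rw [ENNReal.tsum_mul_right, ENNReal.tsum_mul_left, ← ENNReal.ofReal_tsum_of_nonneg (by intro k; positivity) (summable_geometric_of_lt_one ha0.le ha1),
          tsum_geometric_of_lt_one ha0.le ha1, ← ENNReal.ofReal_mul (by positivity), mul_assoc]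



def JI (n : ℕ) (s : ℝ) : ℝ≥0∞ := ∫⁻ x : En n, ENNReal.ofReal ((1 + ‖x‖)^(-s))

lemma JI_fin (n : ℕ) (s : ℝ) (hs : (n:ℝ) < s) : JI n s ≠ ∞ := by
  have := finite_integral_one_add_norm (E := En n) (μ := volume) (r := s) (by simpa using hs)
  exact this.ne

lemma JI_scale (n : ℕ) (s : ℝ) (z : En n) (ρ : ℝ) (hρ : 0 < ρ) :
    ∫⁻ x : En n, ENNReal.ofReal ((1 + ‖x - z‖/ρ)^(-s)) = ENNReal.ofReal (ρ^n) * JI n s := by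
  rw [lintegral_sub_right_eq_self (fun x : En n => ENNReal.ofReal ((1 + ‖x‖/ρ)^(-s))) z]
  have h1 := Measure.map_addHaar_smul (volume : Measure (En n)) (inv_ne_zero hρ.ne')
  have h2 : ∫⁻ x : En n, ENNReal.ofReal ((1 + ‖x‖/ρ)^(-s)) = ∫⁻ x, ENNReal.ofReal ((1 + ‖x‖)^(-s)) ∂(Measure.map (fun x : En n => ρ⁻¹ • x) volume) := by
    rw [lintegral_map (by fun_prop) (by fun_prop)]
    congr 1; ext x
    rw [norm_smul, norm_inv, Real.norm_of_nonneg hρ.le]; congr 3; ring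
  rw [h2]
  erw [h1]
  rw [lintegral_smul_measure]
  simp only [finrank_euclideanSpace, Fintype.card_fin, inv_pow, inv_inv, smul_eq_mul]
  rw [abs_of_pos (by positivity)]; rfl

/-- Property D. -/
lemma propD (n : ℕ) (hn : 1 ≤ n) (q l : ℝ) (hq0 : 0 < q) (hq1 : q ≤ 1) (hl : (n:ℝ) < l) (hlq : (n:ℝ)/q ≤ l) :
    ∃ C : ℝ≥0∞, C ≠ ∞ ∧ ∀ (c b : ℝ≥0∞) (z : En n) (ε : ℝ), 0 < ε → b ≠ 0 → b ≠ ∞ →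
      ∫⁻ x, min b (c * ENNReal.ofReal ((1 + ‖x - z‖/ε)^(-l))) ≤ C * (ENNReal.ofReal (ε^n) * c^q * b^(1-q)) := by
  have hn' : (1:ℝ) ≤ n := by exact_mod_cast hn
  rcases eq_or_lt_of_le hq1 with hq | hq
  · refine ⟨JI n l, JI_fin n l hl, fun c b z ε hε hb hb' => ?_⟩
    calc _ ≤ ∫⁻ x, c * ENNReal.ofReal ((1 + ‖x - z‖/ε)^(-l)) := lintegral_mono fun x => min_le_right _ _
      _ = c * (ENNReal.ofReal (ε^n) * JI n l) := by
        rw [lintegral_const_mul _ (by fun_prop), JI_scale n l z ε hε]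
      _ = _ := by rw [hq]; simp; ring
  · set s := (n:ℝ)/q with hs
    have hsn : (n:ℝ) < s := by rw [hs, lt_div_iff₀ hq0]; nlinarith
    have hs0 : 0 < s := by linarith
    refine ⟨ENNReal.ofReal (2^s) * JI n s + 1, ?_, fun c b z ε hε hb hb' => ?_⟩
    · exact ENNReal.add_ne_top.2 ⟨ENNReal.mul_ne_top ENNReal.ofReal_ne_top (JI_fin n s hsn), by simp⟩
    by_cases hc0 : c = 0
    · simp [hc0]
    by_cases hc : c = ∞
    · have : (ENNReal.ofReal (2^s) * JI n s + 1) * (ENNReal.ofReal (ε^n) * c^q * b^(1-q)) = ∞ := by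
        rw [hc, ENNReal.top_rpow_of_pos hq0, ENNReal.mul_top (by simp; positivity), ENNReal.top_mul, ENNReal.mul_top]
        · simp
        · simp [ENNReal.rpow_eq_zero_iff, hb, hb']
      rw [this]; exact le_top
    set c' := c.toReal with hc'
    set b' := b.toReal with hb''
    have hcp : 0 < c' := ENNReal.toReal_pos hc0 hc
    have hbp : 0 < b' := ENNReal.toReal_pos hb hb'
    have hcE : c = ENNReal.ofReal c' := (ENNReal.ofReal_toReal hc).symm
    have hbE : b = ENNReal.ofReal b' := (ENNReal.ofReal_toReal hb').symm
    set ρ := ε * (c'/b')^(q/n) with hρ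
    have hρ0 : 0 < ρ := by positivity
    have hρn : ρ^n = ε^n * (c'/b')^q := by
      rw [hρ, mul_pow, ← Real.rpow_natCast (_ ^ _), ← Real.rpow_mul (by positivity)]
      congr 2; field_simp
    have hρs : (ρ/ε)^s = c'/b' := by
      rw [hρ, mul_div_cancel_left₀ _ hε.ne', ← Real.rpow_mul (by positivity), hs]
      rw [show q/(n:ℝ) * (n/q) = 1 by field_simp, Real.rpow_one]
    have pt : ∀ x, min b (c * ENNReal.ofReal ((1 + ‖x - z‖/ε)^(-l))) ≤ b * ENNReal.ofReal (2^s) * ENNReal.ofReal ((1 + ‖x - z‖/ρ)^(-s)) := by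
      intro x
      set d := ‖x - z‖ with hd
      have hd0 : 0 ≤ d := norm_nonneg _
      rw [hbE, hcE, ← ENNReal.ofReal_mul hcp.le, ← ENNReal.ofReal_mul hbp.le, ← ENNReal.ofReal_mul (by positivity)]
      rcases le_total d ρ with h | h
      · refine (min_le_left _ _).trans (ENNReal.ofReal_le_ofReal ?_)
        rw [mul_assoc]
        refine le_mul_of_one_le_right hbp.le ?_
        rw [Real.rpow_neg (by positivity), ← div_eq_mul_inv, one_le_div (by positivity)]
        gcongr
        have : d/ρ ≤ 1 := by rw [div_le_one hρ0]; exact h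
        linarith
      · refine (min_le_right _ _).trans (ENNReal.ofReal_le_ofReal ?_)
        have hdp : 0 < d := lt_of_lt_of_le hρ0 h
        have hb1 : (1 + d/ε)^(-l) ≤ (d/ε)^(-s) := by
          calc _ ≤ (1 + d/ε)^(-s) := by
                apply Real.rpow_le_rpow_of_exponent_le _ (by linarith)
                have : 0 ≤ d/ε := by positivity
                linarith
            _ ≤ _ := Real.rpow_le_rpow_of_nonpos (by positivity) (by linarith) (by linarith)
        calc c' * (1 + d/ε)^(-l) ≤ c' * (d/ε)^(-s) := by gcongr
          _ = b' * (d/ρ)^(-s) := by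
            have : d/ε = (d/ρ) * (ρ/ε) := by field_simp
            rw [this, Real.mul_rpow (by positivity) (by positivity), Real.rpow_neg (x := ρ/ε) (by positivity), hρs]
            field_simp
          _ ≤ b' * (2^s * (1 + d/ρ)^(-s)) := by
            gcongr
            rw [Real.rpow_neg (by positivity), Real.rpow_neg (by positivity), ← div_eq_mul_inv,
              ← Real.div_rpow (by positivity) (by positivity), ← Real.inv_rpow (by positivity)]
            gcongr
            have : 1 ≤ d/ρ := by rw [one_le_div hρ0]; exact h
            rw [inv_eq_one_div, div_le_div_iff₀ (by positivity) (by positivity)]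
            linarith
          _ = _ := by ring
    calc _ ≤ ∫⁻ x, b * ENNReal.ofReal (2^s) * ENNReal.ofReal ((1 + ‖x - z‖/ρ)^(-s)) := lintegral_mono pt
      _ = b * ENNReal.ofReal (2^s) * (ENNReal.ofReal (ρ^n) * JI n s) := by
        rw [lintegral_const_mul _ (by fun_prop), JI_scale n s z ρ hρ0]
      _ = (ENNReal.ofReal (2^s) * JI n s) * (ENNReal.ofReal (ε^n) * c^q * b^(1-q)) := by
        have : ENNReal.ofReal b' * ENNReal.ofReal (ρ^n) = ENNReal.ofReal (ε^n) * c^q * b^(1-q) := by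
          rw [hcE, hbE, ENNReal.ofReal_rpow_of_pos hcp, ENNReal.ofReal_rpow_of_pos hbp, ← ENNReal.ofReal_mul (by positivity), ← ENNReal.ofReal_mul (by positivity), ← ENNReal.ofReal_mul (by positivity)]
          congr 1
          rw [hρn, Real.div_rpow hcp.le hbp.le, Real.rpow_sub hbp, Real.rpow_one]; ring
        rw [← this, ← hbE]; ring
      _ ≤ _ := by gcongr; exact le_self_add

/-- lattice points and cells -/
def lat (n : ℕ) (ε : ℝ) (k : Fin n → ℤ) : En n := WithLp.toLp 2 (fun i => ε * (k i : ℝ))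
def cell (n : ℕ) (ε : ℝ) (k : Fin n → ℤ) : Set (En n) :=
  (fun y : En n => (y : Fin n → ℝ)) ⁻¹' (Set.pi univ fun i => Ico (ε * (k i : ℝ)) (ε * (k i : ℝ) + ε))

lemma cell_meas (n : ℕ) (ε : ℝ) (k : Fin n → ℤ) : MeasurableSet (cell n ε k) := by
  unfold cell
  exact (PiLp.volume_preserving_ofLp (Fin n)).measurable (MeasurableSet.univ_pi fun i => measurableSet_Ico)

lemma cell_vol (n : ℕ) (ε : ℝ) (hε : 0 < ε) (k : Fin n → ℤ) : volume (cell n ε k) = ENNReal.ofReal (ε^n) := by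
  unfold cell
  erw [(PiLp.volume_preserving_ofLp (Fin n)).measure_preimage (MeasurableSet.univ_pi fun i => measurableSet_Ico).nullMeasurableSet]
  rw [Real.volume_pi_Ico]
  simp [ENNReal.ofReal_pow hε.le]

lemma cell_floor (n : ℕ) (ε : ℝ) (hε : 0 < ε) (k : Fin n → ℤ) (y : En n) (hy : y ∈ cell n ε k) (i : Fin n) : k i = ⌊y i/ε⌋ := by
  have := hy i (mem_univ i)
  simp only [mem_Ico] at this
  symm; rw [Int.floor_eq_iff, le_div_iff₀ hε, div_lt_iff₀ hε]
  constructor <;> nlinarith [this.1, this.2]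

lemma cell_disj (n : ℕ) (ε : ℝ) (hε : 0 < ε) : Pairwise (Function.onFun Disjoint (cell n ε)) := by
  intro k l hkl
  rw [Function.onFun, Set.disjoint_left]
  intro y hy hy'
  exact hkl (funext fun i => (cell_floor n ε hε k y hy i).trans (cell_floor n ε hε l y hy' i).symm)

lemma cell_cover (n : ℕ) (ε : ℝ) (hε : 0 < ε) (y : En n) : ∃ k, y ∈ cell n ε k := by
  refine ⟨fun i => ⌊y i/ε⌋, fun i _ => ?_⟩
  have h1 := Int.floor_le (y i/ε)
  have h2 := Int.lt_floor_add_one (y i/ε)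
  rw [le_div_iff₀ hε] at h1
  rw [div_lt_iff₀ hε] at h2
  simp only [mem_Ico]
  constructor <;> nlinarith

lemma cell_dist (n : ℕ) (ε : ℝ) (hε : 0 < ε) (k : Fin n → ℤ) (y : En n) (hy : y ∈ cell n ε k) :
    ‖y - lat n ε k‖ ≤ n * ε := by
  have h1 : ‖y - lat n ε k‖^2 ≤ n * ε^2 := by
    rw [EuclideanSpace.norm_sq_eq]
    calc _ ≤ ∑ i : Fin n, ε^2 := by
          apply Finset.sum_le_sum
          intro i _
          have := hy i (mem_univ i)
          simp only [mem_Ico] at this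
          have h3 : (y - lat n ε k) i = y i - ε * k i := by simp [lat]
          rw [h3, Real.norm_eq_abs]
          gcongr
          rw [abs_le]; constructor <;> linarith [this.1, this.2]
      _ = _ := by simp
  have h2 : (n:ℝ) ≤ n^2 := by
    rcases Nat.eq_zero_or_pos n with h | h
    · simp [h]
    · have : (1:ℝ) ≤ n := by exact_mod_cast h
      nlinarith
  apply le_of_sq_le_sq _ (by positivity)
  nlinarith [sq_nonneg ε]

lemma tsum_rpow_le {ι : Type*} (a : ι → ℝ≥0∞) (q : ℝ) (hq0 : 0 < q) (hq1 : q ≤ 1) :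
    (∑' k, a k)^q ≤ ∑' k, (a k)^q := by
  set S := ∑' k, (a k)^q with hS
  have h1 : ∑' k, a k ≤ S^(1/q) := by
    have hex : 0 ≤ 1/q - 1 := by rw [sub_nonneg, le_div_iff₀ hq0]; linarith
    calc ∑' k, a k ≤ ∑' k, (a k)^q * S^(1/q - 1) := by
          gcongr with k
          have : (a k)^q ≤ S := ENNReal.le_tsum k
          calc a k = (a k)^q * ((a k)^q)^(1/q - 1) := by
                rw [← ENNReal.rpow_mul, ← ENNReal.rpow_add_of_nonneg _ _ hq0.le (by positivity)]
                rw [show q + q*(1/q-1) = 1 by field_simp; ring, ENNReal.rpow_one]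
            _ ≤ _ := by gcongr
      _ = S^(1/q) := by
          rw [ENNReal.tsum_mul_right, ← hS]
          nth_rw 1 [← ENNReal.rpow_one S]
          rw [← ENNReal.rpow_add_of_nonneg _ _ (by norm_num) hex]
          congr 1; ring
  calc _ ≤ (S^(1/q))^q := by gcongr
    _ = S := by rw [← ENNReal.rpow_mul]; field_simp; simp



def cinf (n : ℕ) (ε : ℝ) (H : En n → ℝ≥0∞) (k : Fin n → ℤ) : ℝ≥0∞ := ⨅ y ∈ cell n ε k, H y

lemma cinf_le (n : ℕ) (ε : ℝ) (H : En n → ℝ≥0∞) (k : Fin n → ℤ) (y : En n) (hy : y ∈ cell n ε k) :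
    cinf n ε H k ≤ H y := iInf₂_le y hy

lemma cinf_int (n : ℕ) (ε : ℝ) (hε : 0 < ε) (H : En n → ℝ≥0∞) (q : ℝ) (hq : 0 < q) (k : Fin n → ℤ) :
    ENNReal.ofReal (ε^n) * (cinf n ε H k)^q ≤ ∫⁻ y in cell n ε k, (H y)^q := by
  calc _ = ∫⁻ y in cell n ε k, (cinf n ε H k)^q := by rw [setLIntegral_const, cell_vol n ε hε, mul_comm]
    _ ≤ _ := setLIntegral_mono' (cell_meas n ε k) fun y hy => by
      gcongr; exact cinf_le n ε H k y hy

/-- weak-type for sums -/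
lemma near_weak (n : ℕ) {ι : Type*} [Countable ι] (a : ι → En n → ℝ≥0∞) (ha : ∀ k, Measurable (a k)) (b : ℝ≥0∞) :
    b * volume {x | b < ∑' k, a k x} ≤ ∑' k, ∫⁻ x, min b (a k x) := by
  rw [← lintegral_tsum (fun k => (measurable_const.min (ha k)).aemeasurable)]
  have hm : Measurable (fun x => ∑' k, min b (a k x)) := Measurable.ennreal_tsum fun k => measurable_const.min (ha k)
  refine le_trans ?_ (mul_meas_ge_le_lintegral hm b)
  refine mul_le_mul_right (measure_mono ?_) _
  intro x hx
  simp only [mem_ofPred_eq] at hx ⊢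
  by_cases h : ∃ k, b ≤ a k x
  · obtain ⟨k, hk⟩ := h
    calc b = min b (a k x) := (min_eq_left hk).symm
      _ ≤ _ := ENNReal.le_tsum (f := fun k => min b (a k x)) k
  · push Not at h
    have : ∀ k, min b (a k x) = a k x := fun k => min_eq_right (h k).le
    simp only [this]; exact hx.le

lemma far_pt (n : ℕ) (q l : ℝ) (hn : 1 ≤ n) (hq0 : 0 < q) (hlq : (n:ℝ)/q ≤ l) (ε R R' : ℝ) (hε : 0 < ε) (hR : 0 < R)
    (hR' : R' = max R ε) (x x0 z : En n) (hx : ‖x - x0‖ < R) (hz : R < ε ∨ 2*R ≤ ‖z - x0‖) :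
    ENNReal.ofReal ((1 + ‖x - z‖/ε)^(-l))^q ≤ ENNReal.ofReal (3^n) * ENNReal.ofReal (ε^n) * ENNReal.ofReal (((R' + ‖z - x0‖)^n)⁻¹) := by
  have hn' : (1:ℝ) ≤ n := by exact_mod_cast hn
  set d := ‖z - x0‖ with hd
  have hd0 : 0 ≤ d := norm_nonneg _
  set e := ‖x - z‖ with he
  have he0 : 0 ≤ e := norm_nonneg _
  have hRε : ε ≤ R' := by rw [hR']; exact le_max_right _ _
  have htri : d ≤ e + ‖x - x0‖ := by
    have := norm_sub_le_norm_sub_add_norm_sub z x x0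
    rw [norm_sub_rev z x] at this; exact this
  have key : (R' + d)/(3*ε) ≤ 1 + e/ε := by
    rw [div_le_iff₀ (by positivity)]
    have : (1 + e/ε) * (3*ε) = 3*(ε + e) := by field_simp
    rw [this]
    rcases hz with h | h
    · rw [hR', max_eq_right h.le]; linarith
    · rcases le_total R ε with h' | h'
      · rw [hR', max_eq_right h']; linarith
      · rw [hR', max_eq_left h']; linarith
  rw [ENNReal.ofReal_rpow_of_pos (by positivity), ← ENNReal.ofReal_mul (by positivity), ← ENNReal.ofReal_mul (by positivity)]
  apply ENNReal.ofReal_le_ofReal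
  have hRp : 0 < R' := by linarith
  calc ((1 + e/ε)^(-l))^q = (1 + e/ε)^(-l*q) := by rw [← Real.rpow_mul (by positivity)]
    _ ≤ (1 + e/ε)^(-(n:ℝ)) := by
      apply Real.rpow_le_rpow_of_exponent_le
      · have : 0 ≤ e/ε := by positivity
        linarith
      · rw [div_le_iff₀ hq0] at hlq; linarith
    _ ≤ ((R' + d)/(3*ε))^(-(n:ℝ)) := Real.rpow_le_rpow_of_nonpos (by positivity) key (by linarith)
    _ = _ := by
      rw [Real.rpow_neg (by positivity), Real.rpow_natCast, div_pow, inv_div, mul_pow]; ring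

theorem lattice_weak (n : ℕ) (hn : 1 ≤ n) (q l σ : ℝ) (hq0 : 0 < q) (hq1 : q ≤ 1) (hl : (n:ℝ) < l) (hlq : (n:ℝ)/q ≤ l)
    (hσ : 0 ≤ σ) (hσn : σ < n) :
    ∃ C : ℝ≥0∞, C ≠ ∞ ∧ ∀ H : En n → ℝ≥0∞, Measurable H → ∀ T : ℝ≥0∞,
    (∀ x R, 0 < R → ∫⁻ y in Metric.ball x R, (H y)^q ≤ T * ENNReal.ofReal (R^σ)) →
    ∀ ε, 0 < ε → ∀ F : En n → ℝ≥0∞,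
    (∀ x, F x ≤ ∑' k, cinf n ε H k * ENNReal.ofReal ((1 + ‖x - lat n ε k‖/ε)^(-l))) →
    ∀ b : ℝ≥0∞, b ≠ 0 → b ≠ ∞ → ∀ x0 R, 0 < R →
      b^q * volume ({x | b < F x} ∩ Metric.ball x0 R) ≤ C * T * ENNReal.ofReal (R^σ) := by
  obtain ⟨CD, hCD, hD⟩ := propD n hn q l hq0 hq1 hl hlq
  obtain ⟨CF, hCF, hFar⟩ := far_weight n σ hσ hσn
  set CN : ℝ≥0∞ := CD * ENNReal.ofReal ((2 + n)^σ) with hCN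
  set CG : ℝ≥0∞ := ENNReal.ofReal (3^n) * ENNReal.ofReal ((1+n)^n) * CF * vB n with hCG
  refine ⟨(2:ℝ≥0∞)^q * (CN + CG), ?_, ?_⟩
  · refine ENNReal.mul_ne_top (ENNReal.rpow_ne_top_of_nonneg hq0.le (by simp)) (ENNReal.add_ne_top.2 ⟨ENNReal.mul_ne_top hCD ENNReal.ofReal_ne_top, ?_⟩)
    exact ENNReal.mul_ne_top (ENNReal.mul_ne_top (ENNReal.mul_ne_top ENNReal.ofReal_ne_top ENNReal.ofReal_ne_top) hCF) (vB_fin n)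
  intro H hH T hT ε hε F hF b' hb'0 hb'f x0 R hR
  classical
  set b := b'/2 with hb
  have hb0 : b ≠ 0 := by simp [hb, hb'0]
  have hbf : b ≠ ∞ := by simp [hb, ENNReal.div_eq_top, hb'f]
  set c := cinf n ε H with hc
  set a : (Fin n → ℤ) → En n → ℝ≥0∞ := fun k x => c k * ENNReal.ofReal ((1 + ‖x - lat n ε k‖/ε)^(-l)) with ha
  have ham : ∀ k, Measurable (a k) := fun k => by simp only [ha]; fun_prop
  set N : Set (Fin n → ℤ) := {k | ε ≤ R ∧ ‖lat n ε k - x0‖ < 2*R} with hN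
  set S1 : En n → ℝ≥0∞ := fun x => ∑' k, N.indicator (fun k => a k x) k with hS1
  set S2 : En n → ℝ≥0∞ := fun x => ∑' k, Nᶜ.indicator (fun k => a k x) k with hS2
  have hS : ∀ x, F x ≤ S1 x + S2 x := by
    intro x
    refine (hF x).trans (le_of_eq ?_)
    rw [hS1, hS2, ← ENNReal.tsum_add]
    congr 1; ext k
    simp only [indicator, mem_compl_iff]; split_ifs <;> simp_all
  -- near part
  have near : b^q * volume {x | b < S1 x} ≤ CN * T * ENNReal.ofReal (R^σ) := by
    by_cases hRε : ε ≤ R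
    · have h1 := near_weak n (fun k x => N.indicator (fun k => a k x) k) (fun k => by
        by_cases hk : k ∈ N
        · simp only [indicator_of_mem hk]; exact ham k
        · simp only [indicator_of_notMem hk]; exact measurable_const) b
      have h2 : ∑' k, ∫⁻ x, min b (N.indicator (fun k => a k x) k) ≤ ∑' k, CD * b^(1-q) * (N.indicator (fun k => ∫⁻ y in cell n ε k, (H y)^q) k) := by
        gcongr with k
        by_cases hk : k ∈ N
        · simp only [indicator_of_mem hk]
          refine (hD (c k) b (lat n ε k) ε hε hb0 hbf).trans ?_
          calc _ = CD * b^(1-q) * (ENNReal.ofReal (ε^n) * (c k)^q) := by ring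
            _ ≤ _ := by gcongr; exact cinf_int n ε hε H q hq0 k
        · simp [indicator_of_notMem hk]
      have h3 : ∑' k, N.indicator (fun k => ∫⁻ y in cell n ε k, (H y)^q) k ≤ T * ENNReal.ofReal (((2+n)*R)^σ) := by
        refine le_trans ?_ (hT x0 ((2+n)*R) (by positivity))
        rw [← tsum_subtype N (fun k => ∫⁻ y in cell n ε k, (H y)^q), ← lintegral_biUnion N.to_countable (fun k _ => cell_meas n ε k)
          (fun i _ j _ hij => cell_disj n ε hε hij)]
        apply lintegral_mono_set
        intro y hy
        simp only [mem_iUnion] at hy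
        obtain ⟨k, hk, hyk⟩ := hy
        have hd := cell_dist n ε hε k y hyk
        have := norm_sub_le_norm_sub_add_norm_sub y (lat n ε k) x0
        rw [Metric.mem_ball, dist_eq_norm]
        have h4 : (n:ℝ) * ε ≤ n * R := by gcongr
        linarith [hk.2]
      rw [ENNReal.tsum_mul_left] at h2
      have h4 : b * volume {x | b < S1 x} ≤ CD * b^(1-q) * (T * ENNReal.ofReal (((2+n)*R)^σ)) :=
        h1.trans (h2.trans (by gcongr))
      calc b^q * volume {x | b < S1 x} = b^(q-1) * (b * volume {x | b < S1 x}) := by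
            rw [← mul_assoc]; congr 1
            nth_rw 3 [← ENNReal.rpow_one b]
            rw [← ENNReal.rpow_add _ _ hb0 hbf]; congr 1; ring
        _ ≤ b^(q-1) * (CD * b^(1-q) * (T * ENNReal.ofReal (((2+n)*R)^σ))) := by gcongr
        _ = (b^(q-1) * b^(1-q)) * (CD * T * ENNReal.ofReal (((2+n)*R)^σ)) := by ring
        _ = CN * T * ENNReal.ofReal (R^σ) := by
            rw [← ENNReal.rpow_add _ _ hb0 hbf, show q - 1 + (1 - q) = 0 by ring, ENNReal.rpow_zero, one_mul,
              Real.mul_rpow (by positivity) hR.le, ENNReal.ofReal_mul (by positivity), hCN]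
            ring
    · have : N = ∅ := by ext k; simp [hN, hRε]
      have h0 : {x | b < S1 x} = ∅ := by
        ext x; simp [hS1, this]
      rw [h0]; simp
  -- far part
  set R' := max R ε with hR'
  have hR'0 : 0 < R' := lt_max_of_lt_left hR
  set D := ENNReal.ofReal (3^n) * ENNReal.ofReal ((1+n)^n) * CF * T * ENNReal.ofReal (R^(σ-n)) with hDd
  have far : ∀ x ∈ Metric.ball x0 R, (S2 x)^q ≤ D := by
    intro x hx
    rw [Metric.mem_ball, dist_eq_norm] at hx
    calc (S2 x)^q ≤ ∑' k, (Nᶜ.indicator (fun k => a k x) k)^q := tsum_rpow_le _ q hq0 hq1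
      _ ≤ ∑' k, ENNReal.ofReal (3^n) * ENNReal.ofReal ((1+n)^n) * ∫⁻ y in cell n ε k, ENNReal.ofReal (((R' + ‖y - x0‖)^n)⁻¹) * (H y)^q := by
        gcongr with k
        by_cases hk : k ∈ Nᶜ
        · rw [indicator_of_mem hk]
          simp only [ha]
          rw [ENNReal.mul_rpow_of_nonneg _ _ hq0.le]
          have hz : R < ε ∨ 2*R ≤ ‖lat n ε k - x0‖ := by
            by_contra hcon
            push Not at hcon
            exact hk ⟨hcon.1, hcon.2⟩
          have hp := far_pt n q l hn hq0 hlq ε R R' hε hR rfl x x0 (lat n ε k) hx hz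
          set d := ‖lat n ε k - x0‖ with hd
          have hd0 : 0 ≤ d := norm_nonneg _
          calc _ ≤ (c k)^q * (ENNReal.ofReal (3^n) * ENNReal.ofReal (ε^n) * ENNReal.ofReal (((R' + d)^n)⁻¹)) := by gcongr
            _ = ENNReal.ofReal (3^n) * (ENNReal.ofReal (((R' + d)^n)⁻¹) * (ENNReal.ofReal (ε^n) * (c k)^q)) := by ring
            _ ≤ ENNReal.ofReal (3^n) * (ENNReal.ofReal (((R' + d)^n)⁻¹) * ∫⁻ y in cell n ε k, (H y)^q) := by
              gcongr; exact cinf_int n ε hε H q hq0 k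
            _ = ENNReal.ofReal (3^n) * ∫⁻ y in cell n ε k, ENNReal.ofReal (((R' + d)^n)⁻¹) * (H y)^q := by
              rw [lintegral_const_mul' _ _ ENNReal.ofReal_ne_top]
            _ ≤ ENNReal.ofReal (3^n) * ∫⁻ y in cell n ε k, ENNReal.ofReal ((1+n)^n) * (ENNReal.ofReal (((R' + ‖y - x0‖)^n)⁻¹) * (H y)^q) := by
              gcongr ENNReal.ofReal (3^n) * ?_
              apply setLIntegral_mono' (cell_meas n ε k)
              intro y hy
              rw [← mul_assoc]
              gcongr
              rw [← ENNReal.ofReal_mul (by positivity)]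
              apply ENNReal.ofReal_le_ofReal
              have hdist := cell_dist n ε hε k y hy
              have htri := norm_sub_le_norm_sub_add_norm_sub y (lat n ε k) x0
              have hεR : ε ≤ R' := le_max_right _ _
              rw [← div_eq_mul_inv, inv_eq_one_div, div_le_div_iff₀ (by positivity) (by positivity), one_mul, ← mul_pow]
              gcongr
              have h4 : (n:ℝ) * ε ≤ n * R' := by gcongr
              have h5 : 0 ≤ (n:ℝ) * d := by positivity
              nlinarith
            _ = _ := by rw [lintegral_const_mul' _ _ ENNReal.ofReal_ne_top, mul_assoc]
        · rw [indicator_of_notMem hk, ENNReal.zero_rpow_of_pos hq0]; exact zero_le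
      _ = ENNReal.ofReal (3^n) * ENNReal.ofReal ((1+n)^n) * ∫⁻ y in ⋃ k, cell n ε k, ENNReal.ofReal (((R' + ‖y - x0‖)^n)⁻¹) * (H y)^q := by
        rw [ENNReal.tsum_mul_left, lintegral_iUnion (cell_meas n ε) (cell_disj n ε hε)]
      _ ≤ ENNReal.ofReal (3^n) * ENNReal.ofReal ((1+n)^n) * (CF * T * ENNReal.ofReal (R'^(σ-n))) := by
        gcongr
        refine (setLIntegral_le_lintegral _ _).trans ?_
        exact hFar (fun y => (H y)^q) (hH.pow_const q) T hT x0 R' hR'0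
      _ ≤ ENNReal.ofReal (3^n) * ENNReal.ofReal ((1+n)^n) * (CF * T * ENNReal.ofReal (R^(σ-n))) := by
        gcongr _ * (_ * ENNReal.ofReal ?_)
        exact Real.rpow_le_rpow_of_nonpos hR (le_max_left _ _) (by linarith)
      _ = D := by rw [hDd]; ring
  have farV : b^q * volume ({x | b < S2 x} ∩ Metric.ball x0 R) ≤ CG * T * ENNReal.ofReal (R^σ) := by
    by_cases hbD : b^q ≤ D
    · calc _ ≤ D * volume (Metric.ball x0 R) := by gcongr; exact inter_subset_right
        _ = _ := by
          have : ENNReal.ofReal (R^σ) = ENNReal.ofReal (R^(σ-n)) * ENNReal.ofReal (R^n) := by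
            rw [← ENNReal.ofReal_mul (by positivity), ← Real.rpow_natCast, ← Real.rpow_add hR]
            congr 2; ring
          rw [vol_ball n x0 hR, hDd, hCG, this]; ring
    · have : {x | b < S2 x} ∩ Metric.ball x0 R = ∅ := by
        rw [eq_empty_iff_forall_notMem]
        rintro x ⟨h1, h2⟩
        apply hbD
        refine le_trans ?_ (far x h2)
        gcongr; exact le_of_lt h1
      rw [this]; simp
  have hsub : {x | b' < F x} ∩ Metric.ball x0 R ⊆ {x | b < S1 x} ∪ ({x | b < S2 x} ∩ Metric.ball x0 R) := by
    rintro x ⟨h1, h2⟩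
    by_contra hcon
    simp only [mem_union, mem_inter_iff, mem_ofPred_eq, h2, and_true, not_or, not_lt] at hcon
    have : F x ≤ b' := (hS x).trans ((add_le_add hcon.1 hcon.2).trans (by rw [hb, ENNReal.add_halves]))
    exact absurd h1 (not_lt.2 this)
  have hbb : b'^q = 2^q * b^q := by
    rw [← ENNReal.mul_rpow_of_nonneg _ _ hq0.le, hb, ENNReal.mul_div_cancel (by simp) (by simp)]
  calc _ ≤ 2^q * b^q * (volume {x | b < S1 x} + volume ({x | b < S2 x} ∩ Metric.ball x0 R)) := by
        rw [hbb]; gcongr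
        exact (measure_mono hsub).trans (measure_union_le _ _)
    _ = 2^q * (b^q * volume {x | b < S1 x} + b^q * volume ({x | b < S2 x} ∩ Metric.ball x0 R)) := by ring
    _ ≤ 2^q * (CN * T * ENNReal.ofReal (R^σ) + CG * T * ENNReal.ofReal (R^σ)) := by gcongr
    _ = _ := by ring



open SchwartzMap FourierTransform

def cv {n : ℕ} (a f : 𝓢(En n, ℂ)) : 𝓢(En n, ℂ) :=
  SchwartzMap.convolution (ContinuousLinearMap.mul ℂ ℂ) a f

lemma cv_fou {n : ℕ} (a f : 𝓢(En n, ℂ)) (ξ : En n) : 𝓕 (cv a f) ξ = 𝓕 a ξ * 𝓕 f ξ := by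
  unfold cv
  rw [SchwartzMap.fourier_convolution]; rfl

lemma fou_ext {n : ℕ} {a f : 𝓢(En n, ℂ)} (h : ∀ ξ, 𝓕 a ξ = 𝓕 f ξ) : a = f := by
  have : 𝓕 a = 𝓕 f := by ext ξ; exact h ξ
  have h2 : 𝓕⁻ (𝓕 a) = 𝓕⁻ (𝓕 f) := by rw [this]
  simpa using h2

lemma cv_comm {n : ℕ} (a f : 𝓢(En n, ℂ)) : cv a f = cv f a := by
  apply fou_ext; intro ξ; simp [cv_fou, mul_comm]

lemma cv_apply' {n : ℕ} (a f : 𝓢(En n, ℂ)) (x : En n) : cv a f x = ∫ y, a y * f (x - y) := by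
  unfold cv
  rw [SchwartzMap.convolution_apply]; rfl

lemma cv_apply {n : ℕ} (a f : 𝓢(En n, ℂ)) (x : En n) : cv a f x = ∫ y, a (x - y) * f y := by
  rw [cv_comm, cv_apply']
  congr 1; ext y; ring

def dl {n : ℕ} (t : ℝ) (Ψ : 𝓢(En n, ℂ)) : 𝓢(En n, ℂ) :=
  if h : t ≠ 0 then
    ((t^n)⁻¹ : ℝ) • SchwartzMap.compCLMOfContinuousLinearEquiv ℂ
      (ContinuousLinearEquiv.smulLeft (Units.mk0 t⁻¹ (inv_ne_zero h)) : En n ≃L[ℝ] En n) Ψ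
  else 0

lemma dl_apply {n : ℕ} {t : ℝ} (ht : 0 < t) (Ψ : 𝓢(En n, ℂ)) (x : En n) :
    dl t Ψ x = ((t^n)⁻¹ : ℝ) • Ψ (t⁻¹ • x) := by
  unfold dl
  rw [dif_pos ht.ne']
  rfl

lemma dl_fou {n : ℕ} {t : ℝ} (ht : 0 < t) (Ψ : 𝓢(En n, ℂ)) (ξ : En n) :
    𝓕 (dl t Ψ) ξ = 𝓕 Ψ (t • ξ) := by
  rw [SchwartzMap.fourier_coe, SchwartzMap.fourier_coe, Real.fourier_eq, Real.fourier_eq]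
  have := Measure.integral_comp_inv_smul (volume : Measure (En n))
    (fun v => Real.fourierChar (-(inner ℝ v (t • ξ))) • Ψ v) t
  simp only [dl_apply ht]
  rw [finrank_euclideanSpace_fin, abs_of_pos (by positivity)] at this
  have h2 : ∀ v : En n, inner ℝ (t⁻¹ • v) (t • ξ) = inner ℝ v ξ := by
    intro v; rw [real_inner_smul_left, real_inner_smul_right]; field_simp
  simp only [h2] at this
  have h3 : ∀ v : En n, Real.fourierChar (-(inner ℝ v ξ)) • ((t^n)⁻¹ : ℝ) • Ψ (t⁻¹ • v) =
     ((t^n)⁻¹ : ℝ) • (Real.fourierChar (-(inner ℝ v ξ)) • Ψ (t⁻¹ • v)) := by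
    intro v; rw [smul_comm]
  simp only [h3]
  rw [integral_smul, this, smul_smul, inv_mul_cancel₀ (by positivity), one_smul]

lemma ex_fou {n : ℕ} (g : En n → ℂ) (h1 : HasCompactSupport g) (h2 : ContDiff ℝ ((⊤:ℕ∞):WithTop ℕ∞) g) :
    ∃ ψ : 𝓢(En n, ℂ), ∀ ξ, 𝓕 ψ ξ = g ξ := by
  refine ⟨𝓕⁻ (h1.toSchwartzMap h2), fun ξ => ?_⟩
  simp

lemma ex_div {n : ℕ} (θ g : En n → ℂ) (h1 : HasCompactSupport θ) (h2 : ContDiff ℝ ((⊤:ℕ∞):WithTop ℕ∞) θ)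
    (h3 : ContDiff ℝ ((⊤:ℕ∞):WithTop ℕ∞) g) (h4 : ∀ ξ ∈ tsupport θ, g ξ ≠ 0) :
    ∃ ψ : 𝓢(En n, ℂ), ∀ ξ, 𝓕 ψ ξ * g ξ = θ ξ := by
  obtain ⟨ψ, hψ⟩ := ex_fou (fun ξ => θ ξ * (g ξ)⁻¹) (h1.mul_right) (by
    rw [contDiff_iff_contDiffAt]
    intro ξ
    by_cases hξ : ξ ∈ tsupport θ
    · exact h2.contDiffAt.mul (h3.contDiffAt.inv (h4 ξ hξ))
    · have : (fun ξ => θ ξ * (g ξ)⁻¹) =ᶠ[nhds ξ] fun _ => 0 := by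
        filter_upwards [(isClosed_tsupport θ).isOpen_compl.mem_nhds hξ] with y hy
        rw [image_eq_zero_of_notMem_tsupport hy, zero_mul]
      exact contDiffAt_const.congr_of_eventuallyEq this)
  refine ⟨ψ, fun ξ => ?_⟩
  rw [hψ]
  by_cases hg : g ξ = 0
  · have : ξ ∉ tsupport θ := fun h => h4 ξ h hg
    rw [hg, image_eq_zero_of_notMem_tsupport this]; simp
  · field_simp

lemma setupΦ {n : ℕ} (Φ : 𝓢(En n, ℂ)) (hΦ : (∫ x, Φ x) ≠ 0) (N : ℕ) :
    ∃ a : ℝ, 0 < a ∧ ∃ Θ ψ ρ Φ' : 𝓢(En n, ℂ), (∀ ξ, ‖ξ‖ ≤ a → 𝓕 Θ ξ = 1) ∧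
      (∀ ξ, 𝓕 ψ ξ * 𝓕 Φ ξ = 𝓕 Θ ξ) ∧
      (∀ ξ, 𝓕 ρ ξ * (𝓕 Φ ξ * ((‖ξ‖^2 : ℝ):ℂ)^N) = 𝓕 Θ ξ - 𝓕 Θ ((2:ℝ) • ξ)) ∧
      (∀ ξ, 𝓕 Φ' ξ = 𝓕 Φ ξ * ((‖ξ‖^2 : ℝ):ℂ)^N) := by
  have h0 : 𝓕 Φ 0 ≠ 0 := by
    rw [SchwartzMap.fourier_coe, Real.fourier_eq]; simpa using hΦ
  have hc : Continuous (𝓕 Φ : 𝓢(En n, ℂ)) := (𝓕 Φ).continuous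
  have hev := hc.continuousAt.eventually_ne h0
  obtain ⟨b, hb, hball⟩ := Metric.eventually_nhds_iff_ball.1 hev
  set a := b / 4 with ha
  have hapos : 0 < a := by positivity
  let θ : ContDiffBump (0 : En n) := ⟨a, 2*a, hapos, by linarith⟩
  have hθ : ContDiff ℝ ((⊤:ℕ∞):WithTop ℕ∞) (fun ξ => ((θ ξ : ℝ) : ℂ)) :=
    Complex.ofRealCLM.contDiff.comp θ.contDiff
  have hθc : HasCompactSupport (fun ξ => ((θ ξ : ℝ) : ℂ)) :=
    θ.hasCompactSupport.comp_left (g := fun x : ℝ => (x:ℂ)) (by simp)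
  have hts : tsupport (fun ξ => ((θ ξ : ℝ) : ℂ)) ⊆ Metric.closedBall 0 (2*a) := by
    rw [← show θ.rOut = 2*a from rfl, ← θ.tsupport_eq]
    exact closure_mono (Function.support_comp_subset (g := fun x : ℝ => (x:ℂ)) (by simp) _)
  have hsm : ContDiff ℝ ((⊤:ℕ∞):WithTop ℕ∞) (𝓕 Φ : 𝓢(En n, ℂ)) := (𝓕 Φ).smooth _
  obtain ⟨Θ, hΘ⟩ := ex_fou _ hθc hθ
  have hne : ∀ ξ ∈ Metric.closedBall (0:En n) (2*a), 𝓕 Φ ξ ≠ 0 := by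
    intro ξ hξ
    apply hball
    rw [Metric.mem_closedBall] at hξ
    rw [Metric.mem_ball]; linarith
  obtain ⟨ψ, hψ⟩ := ex_div _ (𝓕 Φ : 𝓢(En n, ℂ)) hθc hθ hsm (fun ξ hξ => hne ξ (hts hξ))
  have hpow : ContDiff ℝ ((⊤:ℕ∞):WithTop ℕ∞) (fun ξ : En n => ((‖ξ‖^2 : ℝ):ℂ)^N) :=
    (Complex.ofRealCLM.contDiff.comp (contDiff_norm_sq ℝ)).pow N
  have hpg : (fun ξ : En n => ((‖ξ‖^2 : ℝ):ℂ)^N).HasTemperateGrowth := by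
    fun_prop
  let Φ' : 𝓢(En n, ℂ) := 𝓕⁻ (SchwartzMap.smulLeftCLM ℂ (fun ξ : En n => ((‖ξ‖^2 : ℝ):ℂ)^N) (𝓕 Φ))
  have hη : ContDiff ℝ ((⊤:ℕ∞):WithTop ℕ∞) (fun ξ => ((θ ξ : ℝ) : ℂ) - ((θ ((2:ℝ)•ξ) : ℝ) : ℂ)) :=
    hθ.sub (hθ.comp (contDiff_const_smul (2:ℝ)))
  have hz : ∀ ξ : En n, 2*a ≤ ‖ξ‖ → θ ξ = 0 := by
    intro ξ hξ; apply θ.zero_of_le_dist; simpa using hξ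
  have ho : ∀ ξ : En n, ‖ξ‖ ≤ a → θ ξ = 1 := by
    intro ξ hξ; apply θ.one_of_mem_closedBall; simpa using hξ
  have hηs : tsupport (fun ξ => ((θ ξ : ℝ) : ℂ) - ((θ ((2:ℝ)•ξ) : ℝ) : ℂ)) ⊆
      Metric.closedBall 0 (2*a) ∩ {ξ | a/2 ≤ ‖ξ‖} := by
    apply closure_minimal
    · intro ξ hξ
      constructor
      · by_contra h
        simp only [Metric.mem_closedBall, dist_zero_right, not_le] at h
        apply hξ
        simp only
        rw [hz ξ h.le, hz _ (by rw [norm_smul]; norm_num; linarith)]; simp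
      · by_contra h
        simp only [mem_ofPred_eq, not_le] at h
        apply hξ
        simp only
        rw [ho ξ (by linarith), ho _ (by rw [norm_smul]; norm_num; linarith)]; simp
    · exact Metric.isClosed_closedBall.inter (isClosed_le continuous_const continuous_norm)
  have hηc : HasCompactSupport (fun ξ => ((θ ξ : ℝ) : ℂ) - ((θ ((2:ℝ)•ξ) : ℝ) : ℂ)) :=
    (isCompact_closedBall (0:En n) (2*a)).of_isClosed_subset (isClosed_tsupport _)
      (hηs.trans inter_subset_left)
  obtain ⟨ρ, hρ⟩ := ex_div _ (fun ξ => 𝓕 Φ ξ * ((‖ξ‖^2 : ℝ):ℂ)^N) hηc hη (hsm.mul hpow) (by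
    intro ξ hξ
    have h := hηs hξ
    refine mul_ne_zero (hne ξ h.1) (pow_ne_zero _ ?_)
    have h2 : a/2 ≤ ‖ξ‖ := h.2
    have : 0 < ‖ξ‖ := by linarith
    exact_mod_cast (by positivity : ‖ξ‖^2 ≠ 0))
  refine ⟨a, hapos, Θ, ψ, ρ, Φ', ?_, ?_, ?_, ?_⟩
  · intro ξ hξ; rw [hΘ, ho ξ hξ]; simp
  · intro ξ; rw [hψ, hΘ]
  · intro ξ; rw [hρ, hΘ, hΘ]
  · intro ξ
    simp only [Φ', FourierTransform.fourier_fourierInv_eq]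
    rw [SchwartzMap.smulLeftCLM_apply_apply hpg]
    simp [mul_comm]



lemma sch_decay {n : ℕ} (a : 𝓢(En n, ℂ)) (K : ℕ) :
    ∃ C : ℝ, 0 ≤ C ∧ ∀ x, ‖a x‖ ≤ C * ((1+‖x‖)^K)⁻¹ := by
  have h := fun x => SchwartzMap.one_add_le_sup_seminorm_apply (𝕜 := ℝ) (m := (K,0)) (k := K) (n := 0)
    le_rfl le_rfl a x
  refine ⟨2^K * (Finset.Iic (K,0)).sup (fun m => SchwartzMap.seminorm ℝ m.1 m.2) a,
    by positivity, fun x => ?_⟩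
  · have h1 := h x
    rw [norm_iteratedFDeriv_zero] at h1
    have : 0 < (1+‖x‖)^K := by positivity
    rw [← div_eq_mul_inv, le_div_iff₀ this, mul_comm]
    exact h1

lemma sch_int {n : ℕ} (b : 𝓢(En n, ℂ)) (K : ℕ) : Integrable (fun y => (1+‖y‖)^K * ‖b y‖) := by
  have h1 := b.integrable_pow_mul volume K
  have h0 := b.integrable_pow_mul volume 0
  refine ((h0.add h1).const_mul (2^K)).mono' (by fun_prop) (Filter.Eventually.of_forall fun y => ?_)
  rw [Real.norm_of_nonneg (by positivity)]
  have h2 := add_pow_le (zero_le_one) (norm_nonneg y) K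
  have h3 : (2:ℝ)^(K-1) ≤ 2^K := pow_le_pow_right₀ (by norm_num) (by omega)
  simp only [Pi.add_apply, pow_zero, one_pow] at *
  calc (1+‖y‖)^K * ‖b y‖ ≤ (2^(K-1) * (1 + ‖y‖^K)) * ‖b y‖ := by gcongr
    _ ≤ (2^K * (1 + ‖y‖^K)) * ‖b y‖ := by gcongr
    _ = _ := by ring

lemma peetre {n : ℕ} (x y : En n) {t : ℝ} (ht : 0 < t) :
    1 + ‖x‖/t ≤ (1+‖x-y‖/t)*(1+‖y‖/t) := by
  have h : ‖x‖ ≤ ‖x-y‖ + ‖y‖ := by simpa using norm_add_le (x-y) y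
  have h2 : ‖x‖/t ≤ ‖x-y‖/t + ‖y‖/t := by rw [← add_div]; gcongr
  have : 0 ≤ ‖x-y‖/t * (‖y‖/t) := by positivity
  nlinarith

lemma cvdec {n : ℕ} (a b : 𝓢(En n, ℂ)) (K : ℕ) :
    ∃ C : ℝ, 0 ≤ C ∧ ∀ t u, 0 < u → u ≤ t → ∀ x, ‖cv (dl t a) (dl u b) x‖ ≤
      C * ((t^n)⁻¹ * ((1+‖x‖/t)^K)⁻¹) := by
  obtain ⟨Ca, hCa, hA⟩ := sch_decay a K
  have hI := sch_int b K
  refine ⟨Ca * ∫ y, (1+‖y‖)^K * ‖b y‖, by positivity, fun t u hu hut x => ?_⟩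
  have ht : 0 < t := hu.trans_le hut
  rw [cv_apply]
  have hcov := Measure.integral_comp_inv_smul (volume : Measure (En n))
    (fun y => (1+‖y‖)^K * ‖b y‖) u
  rw [finrank_euclideanSpace_fin, abs_of_pos (by positivity), smul_eq_mul] at hcov
  have hI2 : Integrable (fun y : En n => (1+‖u⁻¹ • y‖)^K * ‖b (u⁻¹ • y)‖) :=
    hI.comp_smul (inv_ne_zero hu.ne')
  refine (norm_integral_le_of_norm_le (hI2.const_mul
    (Ca * ((t^n)⁻¹ * ((1+‖x‖/t)^K)⁻¹) * (u^n)⁻¹)) (Filter.Eventually.of_forall fun y => ?_)).trans ?_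
  · rw [norm_mul, dl_apply ht, dl_apply hu, norm_smul, norm_smul,
      Real.norm_of_nonneg (by positivity), Real.norm_of_nonneg (by positivity)]
    have h1 : ‖a (t⁻¹ • (x-y))‖ ≤ Ca * (((1+‖x‖/t)^K)⁻¹ * (1+‖u⁻¹ • y‖)^K) := by
      refine (hA _).trans ?_
      gcongr
      rw [← div_eq_inv_mul, inv_le_comm₀ (by positivity) (by positivity), inv_div,
        div_le_iff₀ (by positivity), ← mul_pow]
      gcongr
      refine (peetre x y ht).trans ?_
      rw [norm_smul, norm_smul, Real.norm_of_nonneg (by positivity), Real.norm_of_nonneg (by positivity),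
        ← div_eq_inv_mul, ← div_eq_inv_mul]
      gcongr
    calc (t^n)⁻¹ * ‖a (t⁻¹ • (x-y))‖ * ((u^n)⁻¹ * ‖b (u⁻¹ • y)‖) ≤
       (t^n)⁻¹ * (Ca * (((1+‖x‖/t)^K)⁻¹ * (1+‖u⁻¹ • y‖)^K)) * ((u^n)⁻¹ * ‖b (u⁻¹ • y)‖) := by gcongr
      _ = _ := by ring
  · rw [integral_const_mul, hcov]
    apply le_of_eq
    field_simp

lemma fou_add {n : ℕ} (f g : 𝓢(En n, ℂ)) (ξ : En n) : 𝓕 (f + g) ξ = 𝓕 f ξ + 𝓕 g ξ := by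
  rw [FourierTransform.fourier_add]; rfl
lemma fou_smul {n : ℕ} (c : ℂ) (g : 𝓢(En n, ℂ)) (ξ : En n) : 𝓕 (c • g) ξ = c * 𝓕 g ξ := by
  rw [FourierTransform.fourier_smul]; rfl

lemma tele {n : ℕ} (Φ Θ ψ ρ Φ' : 𝓢(En n, ℂ)) (N : ℕ)
     (h2 : ∀ ξ, 𝓕 ψ ξ * 𝓕 Φ ξ = 𝓕 Θ ξ)
     (h3 : ∀ ξ, 𝓕 ρ ξ * (𝓕 Φ ξ * ((‖ξ‖^2 : ℝ):ℂ)^N) = 𝓕 Θ ξ - 𝓕 Θ ((2:ℝ) • ξ))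
     (h4 : ∀ ξ, 𝓕 Φ' ξ = 𝓕 Φ ξ * ((‖ξ‖^2 : ℝ):ℂ)^N) (f : 𝓢(En n, ℂ)) (t : ℝ) (ht : 0 < t) (J : ℕ) :
    cv (dl (t/2^J) Θ) (cv (dl t Φ) f) = cv (cv (dl t Φ) (dl t ψ)) (cv (dl t Φ) f) +
      ∑ k ∈ Finset.range J, (((1/4:ℝ)^(N*(k+1)) : ℝ):ℂ) •
        cv (cv (dl t Φ') (dl (t/2^(k+1)) ρ)) (cv (dl (t/2^(k+1)) Φ) f) := by
  induction J with
  | zero =>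
    apply fou_ext; intro ξ
    simp only [pow_zero, div_one, Finset.range_zero, Finset.sum_empty, add_zero, cv_fou, dl_fou ht]
    rw [← h2]; ring
  | succ J ih =>
    rw [Finset.sum_range_succ, ← add_assoc, ← ih]
    apply fou_ext; intro ξ
    have hs : 0 < t/2^(J+1) := by positivity
    have hs' : 0 < t/2^J := by positivity
    simp only [fou_add, fou_smul, cv_fou, dl_fou ht, dl_fou hs, dl_fou hs']
    have e : (t/2^J) • ξ = (2:ℝ) • ((t/2^(J+1)) • ξ) := by
      rw [smul_smul]; congr 1; field_simp; ring
    have := h3 ((t/2^(J+1)) • ξ)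
    rw [← e] at this
    rw [h4, eq_comm, ← sub_eq_zero]
    have e2 : ((‖t • ξ‖^2 : ℝ):ℂ)^N * (((1/4:ℝ)^(N*(J+1)) : ℝ):ℂ) = ((‖(t/2^(J+1)) • ξ‖^2 : ℝ):ℂ)^N := by
      rw [← Complex.ofReal_pow, ← Complex.ofReal_pow, ← Complex.ofReal_mul]
      congr 1
      rw [mul_comm N, pow_mul, ← mul_pow]
      congr 1
      rw [norm_smul, norm_smul, Real.norm_of_nonneg ht.le, Real.norm_of_nonneg hs.le, mul_pow, mul_pow,
        div_pow, div_pow, one_pow]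
      have h4 : (4:ℝ)^(J+1) = (2^(J+1))^2 := by rw [← pow_mul, mul_comm, pow_mul]; norm_num
      rw [h4]; ring
    rw [← e2] at this
    linear_combination (𝓕 Φ (t•ξ) * 𝓕 f ξ) * this

lemma cv_bdd {n : ℕ} (a : 𝓢(En n, ℂ)) : ∃ B, 0 ≤ B ∧ ∀ x, ‖a x‖ ≤ B := by
  obtain ⟨C, h, h'⟩ := sch_decay a 0
  exact ⟨C, h, fun x => by simpa using h' x⟩

/-- approximate identity -/
lemma apx {n : ℕ} (Θ : 𝓢(En n, ℂ)) (h : 𝓕 Θ 0 = 1) (g : 𝓢(En n, ℂ)) (t : ℝ) (ht : 0 < t) (z : En n) :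
    Filter.Tendsto (fun J : ℕ => cv (dl (t/2^J) Θ) g z) Filter.atTop (nhds (g z)) := by
  have hIntA : (∫ x, Θ x) = 1 := by
    rw [SchwartzMap.fourier_coe, Real.fourier_eq] at h; simpa using h
  have e : ∀ J : ℕ, cv (dl (t/2^J) Θ) g z = ∫ w, Θ w * g (z - (t/2^J) • w) := by
    intro J
    have hs : 0 < t/2^J := by positivity
    rw [cv_apply']
    have := Measure.integral_comp_inv_smul (volume : Measure (En n))
      (fun w => Θ w * g (z - (t/2^J) • w)) (t/2^J)
    rw [finrank_euclideanSpace_fin, abs_of_pos (by positivity)] at this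
    simp only [dl_apply hs, smul_mul_assoc]
    rw [integral_smul]
    simp only [smul_smul, mul_inv_cancel₀ hs.ne', one_smul] at this
    rw [this, smul_smul, inv_mul_cancel₀ (by positivity), one_smul]
  simp only [e]
  obtain ⟨B, hB, hb⟩ := cv_bdd g
  have e2 : g z = ∫ w, Θ w * g z := by rw [integral_mul_const, hIntA, one_mul]
  rw [e2]
  apply tendsto_integral_of_dominated_convergence (fun w => ‖Θ w‖ * B)
  · intro J
    exact (Θ.continuous.mul (g.continuous.comp (by fun_prop))).aestronglyMeasurable
  · exact Θ.integrable.norm.mul_const B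
  · intro J; filter_upwards with w; rw [norm_mul]; gcongr; exact hb _
  · filter_upwards with w
    apply Filter.Tendsto.const_mul
    have : Filter.Tendsto (fun J : ℕ => z - (t/2^J) • w) Filter.atTop (nhds (z - (0:ℝ) • w)) := by
      apply Filter.Tendsto.const_sub
      apply Filter.Tendsto.smul_const
      apply Filter.Tendsto.const_div_atTop
      exact tendsto_pow_atTop_atTop_of_one_lt (by norm_num)
    rw [zero_smul, sub_zero] at this
    exact (g.continuous.tendsto z).comp this



def Pm {n : ℕ} (Φ f : 𝓢(En n, ℂ)) (L : ℕ) (x : En n) : ℝ≥0∞ :=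
  ⨆ (t : ℝ) (_ : 0 < t) (z : En n), ‖cv (dl t Φ) f z‖ₑ * ENNReal.ofReal (((1+‖x-z‖/t)^L)⁻¹)

lemma Pm_ge {n : ℕ} (Φ f : 𝓢(En n, ℂ)) (L : ℕ) (x z : En n) {t : ℝ} (ht : 0 < t) :
    ‖cv (dl t Φ) f z‖ₑ ≤ Pm Φ f L x * ENNReal.ofReal ((1+‖x-z‖/t)^L) := by
  have h : ‖cv (dl t Φ) f z‖ₑ * ENNReal.ofReal (((1+‖x-z‖/t)^L)⁻¹) ≤ Pm Φ f L x :=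
    le_iSup_of_le t (le_iSup_of_le ht (le_iSup_of_le z le_rfl))
  calc ‖cv (dl t Φ) f z‖ₑ = ‖cv (dl t Φ) f z‖ₑ * ENNReal.ofReal (((1+‖x-z‖/t)^L)⁻¹) *
        ENNReal.ofReal ((1+‖x-z‖/t)^L) := by
        rw [mul_assoc, ← ENNReal.ofReal_mul (by positivity), inv_mul_cancel₀ (by positivity)]; simp
    _ ≤ _ := by gcongr

lemma radMax_eq {n : ℕ} (Φ f : 𝓢(En n, ℂ)) (x : En n) :
    radMax n Φ f x = ⨆ (t : ℝ) (_ : 0 < t), ‖cv (dl t Φ) f x‖ₑ := by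
  unfold radMax
  congr 1; ext t; congr 1; ext ht
  rw [cv_apply]
  simp only [dl_apply ht]
  rfl

lemma radMax_ge {n : ℕ} (Φ f : 𝓢(En n, ℂ)) (x : En n) {t : ℝ} (ht : 0 < t) :
    ‖cv (dl t Φ) f x‖ₑ ≤ radMax n Φ f x := by
  rw [radMax_eq]; exact le_iSup_of_le t (le_iSup_of_le ht le_rfl)

lemma radMax_meas {n : ℕ} (Φ f : 𝓢(En n, ℂ)) : Measurable (radMax n Φ f) := by
  have : radMax n Φ f = fun x => ⨆ (t : ℝ) (_ : 0 < t), ‖cv (dl t Φ) f x‖ₑ := by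
    ext x; exact radMax_eq Φ f x
  rw [this]
  apply LowerSemicontinuous.measurable
  apply lowerSemicontinuous_iSup; intro t
  apply lowerSemicontinuous_iSup; intro ht
  exact ((cv (dl t Φ) f).continuous.enorm).lowerSemicontinuous

lemma Pm_fin {n : ℕ} (Φ f : 𝓢(En n, ℂ)) (L : ℕ) (x : En n) : Pm Φ f L x ≠ ∞ := by
  obtain ⟨B, hB, hb⟩ := cv_bdd f
  refine ne_top_of_le_ne_top (b := ENNReal.ofReal ((∫ y, ‖Φ y‖) * B)) ENNReal.ofReal_ne_top ?_
  refine iSup_le fun t => iSup_le fun ht => iSup_le fun z => ?_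
  have h1 : ‖cv (dl t Φ) f z‖ ≤ (∫ y, ‖Φ y‖) * B := by
    rw [cv_apply']
    have hcov := Measure.integral_comp_inv_smul (volume : Measure (En n)) (fun y => ‖Φ y‖) t
    rw [finrank_euclideanSpace_fin, abs_of_pos (by positivity), smul_eq_mul] at hcov
    refine (norm_integral_le_of_norm_le (((dl t Φ).integrable.norm).mul_const B)
      (Filter.Eventually.of_forall fun y => ?_)).trans ?_
    · rw [norm_mul]; gcongr; exact hb _
    · rw [integral_mul_const]
      refine mul_le_mul_of_nonneg_right ?_ hB
      simp only [dl_apply ht, norm_smul]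
      rw [integral_const_mul, hcov, Real.norm_of_nonneg (by positivity)]
      apply le_of_eq; field_simp
  calc _ ≤ ‖cv (dl t Φ) f z‖ₑ * 1 := by
        gcongr
        rw [ENNReal.ofReal_le_one]
        apply inv_le_one_of_one_le₀
        apply one_le_pow₀
        have : 0 ≤ ‖x-z‖/t := by positivity
        linarith
    _ ≤ _ := by
      rw [mul_one, ← ofReal_norm]
      exact ENNReal.ofReal_le_ofReal h1

lemma step_real (n k L : ℕ) (r D E F : ℝ) (hr : 0 < r) (hr1 : r ≤ 1) (hL : (n:ℝ)+1 ≤ L*r) (hD : 1 ≤ D)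
    (hE : 1 ≤ E) (hF : 1 ≤ F) (hDEF : D ≤ E * F) (A : ℝ) (hA : 0 ≤ A) (hAD : A ≤ 2^k * D) :
    (F^L)⁻¹ * ((A^L)^(1-r)) * (E^L)⁻¹ ≤ 2^(k*L) * (D^(n+1))⁻¹ := by
  have hDp : 0 < D := by linarith
  have h1 : (A^L)^(1-r) ≤ ((2^k)^L * D^L)^(1-r) := by
    apply Real.rpow_le_rpow (by positivity) _ (by linarith)
    rw [← mul_pow]; gcongr
  have h2 : ((2^k)^L * D^L)^(1-r) ≤ (2:ℝ)^(k*L) * (D^L * (D^(n+1))⁻¹) := by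
    rw [Real.mul_rpow (by positivity) (by positivity)]
    gcongr
    · rw [← pow_mul]
      calc ((2:ℝ)^(k*L))^(1-r) ≤ ((2:ℝ)^(k*L))^(1:ℝ) :=
            Real.rpow_le_rpow_of_exponent_le (one_le_pow₀ (by norm_num)) (by linarith)
        _ = _ := Real.rpow_one _
    · rw [← div_eq_mul_inv, ← Real.rpow_natCast D L, ← Real.rpow_natCast D (n+1), ← Real.rpow_sub hDp,
        ← Real.rpow_mul hDp.le]
      apply Real.rpow_le_rpow_of_exponent_le hD
      push_cast; linarith
  have h3 : D^L ≤ E^L * F^L := by rw [← mul_pow]; gcongr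
  calc (F^L)⁻¹ * ((A^L)^(1-r)) * (E^L)⁻¹ ≤ (F^L)⁻¹ * ((2:ℝ)^(k*L) * (D^L * (D^(n+1))⁻¹)) * (E^L)⁻¹ := by
        gcongr; exact h1.trans h2
    _ ≤ (F^L)⁻¹ * ((2:ℝ)^(k*L) * ((E^L * F^L) * (D^(n+1))⁻¹)) * (E^L)⁻¹ := by gcongr
    _ = _ := by field_simp

lemma step {n : ℕ} (Φ f Kf : 𝓢(En n, ℂ)) (k L : ℕ) (r C0 : ℝ) (hr : 0 < r) (hr1 : r ≤ 1)
    (hL : (n:ℝ)+1 ≤ L*r) (hC0 : 0 ≤ C0) (t : ℝ) (ht : 0 < t)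
    (hK : ∀ w, ‖Kf w‖ ≤ C0 * ((t^n)⁻¹ * ((1+‖w‖/t)^L)⁻¹)) (x z : En n) :
    ‖cv Kf (cv (dl (t/2^k) Φ) f) z‖ₑ * ENNReal.ofReal (((1+‖x-z‖/t)^L)⁻¹) ≤
      ENNReal.ofReal (C0 * 2^(k*L) * 2^(n+2)) * ((Pm Φ f L x)^(1-r) *
        HL n (fun y => (radMax n Φ f y)^r) x) := by
  have hs : 0 < t/2^k := by positivity
  have hm : Measurable (fun y => (radMax n Φ f y)^r) := (radMax_meas Φ f).pow_const r
  have hker := HL_kernel n _ hm x t ht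
  have hpt : ∀ y, ‖Kf (z-y) * cv (dl (t/2^k) Φ) f y‖ₑ * ENNReal.ofReal (((1+‖x-z‖/t)^L)⁻¹) ≤
      ENNReal.ofReal (C0 * 2^(k*L)) * (Pm Φ f L x)^(1-r) *
       (ENNReal.ofReal ((t^n)⁻¹ * ((1+‖x-y‖/t)^(n+1))⁻¹) * (radMax n Φ f y)^r) := by
    intro y
    set e := ‖cv (dl (t/2^k) Φ) f y‖ₑ with he
    set A := 1+‖x-y‖/(t/2^k) with hA
    have hApos : 0 ≤ A := by positivity
    have h1 : e ≤ (Pm Φ f L x)^(1-r) * ENNReal.ofReal ((A^L)^(1-r)) * (radMax n Φ f y)^r := by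
      calc e = e^(1-r) * e^r := by
            rw [← ENNReal.rpow_add_of_nonneg _ _ (by linarith) hr.le]; simp
        _ ≤ (Pm Φ f L x * ENNReal.ofReal (A^L))^(1-r) * (radMax n Φ f y)^r := by
            gcongr
            · exact Pm_ge Φ f L x y hs
            · exact radMax_ge Φ f y hs
        _ = _ := by
            rw [ENNReal.mul_rpow_of_nonneg _ _ (by linarith),
              ENNReal.ofReal_rpow_of_nonneg (by positivity) (by linarith)]
    have h2 : ‖Kf (z-y)‖ₑ ≤ ENNReal.ofReal (C0 * ((t^n)⁻¹ * ((1+‖z-y‖/t)^L)⁻¹)) := by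
      rw [← ofReal_norm]; exact ENNReal.ofReal_le_ofReal (hK _)
    have h3 := step_real n k L r (1+‖x-y‖/t) (1+‖x-z‖/t) (1+‖z-y‖/t) hr hr1 hL
      (by have : 0 ≤ ‖x-y‖/t := by positivity
          linarith) (by have : 0 ≤ ‖x-z‖/t := by positivity
                        linarith) (by have : 0 ≤ ‖z-y‖/t := by positivity
                                      linarith)
      (by have := peetre (x-y) (z-y) ht
          simpa using this) A hApos (by
          have h2k : (1:ℝ) ≤ 2^k := one_le_pow₀ (by norm_num)
          have : A = 1 + 2^k * (‖x-y‖/t) := by rw [hA]; field_simp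
          rw [this]; linarith)
    rw [enorm_mul]
    calc ‖Kf (z-y)‖ₑ * e * ENNReal.ofReal (((1+‖x-z‖/t)^L)⁻¹) ≤
        ENNReal.ofReal (C0 * ((t^n)⁻¹ * ((1+‖z-y‖/t)^L)⁻¹)) *
         ((Pm Φ f L x)^(1-r) * ENNReal.ofReal ((A^L)^(1-r)) * (radMax n Φ f y)^r) *
         ENNReal.ofReal (((1+‖x-z‖/t)^L)⁻¹) := by gcongr
      _ = ENNReal.ofReal (C0 * ((t^n)⁻¹ * ((1+‖z-y‖/t)^L)⁻¹)) * ENNReal.ofReal ((A^L)^(1-r)) *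
          ENNReal.ofReal (((1+‖x-z‖/t)^L)⁻¹) * ((Pm Φ f L x)^(1-r) * (radMax n Φ f y)^r) := by ring
      _ ≤ ENNReal.ofReal (C0 * 2^(k*L)) * ENNReal.ofReal ((t^n)⁻¹ * ((1+‖x-y‖/t)^(n+1))⁻¹) *
          ((Pm Φ f L x)^(1-r) * (radMax n Φ f y)^r) := by
          rw [← ENNReal.ofReal_mul (by positivity), ← ENNReal.ofReal_mul (by positivity),
            ← ENNReal.ofReal_mul (by positivity)]
          gcongr ENNReal.ofReal ?_ * _
          calc _ = C0 * (t^n)⁻¹ * (((1+‖z-y‖/t)^L)⁻¹ * (A^L)^(1-r) * ((1+‖x-z‖/t)^L)⁻¹) := by ring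
            _ ≤ C0 * (t^n)⁻¹ * (2^(k*L) * ((1+‖x-y‖/t)^(n+1))⁻¹) := by gcongr
            _ = _ := by ring
      _ = _ := by ring
  rw [cv_apply]
  calc _ ≤ (∫⁻ y, ‖Kf (z-y) * cv (dl (t/2^k) Φ) f y‖ₑ) * ENNReal.ofReal (((1+‖x-z‖/t)^L)⁻¹) := by
        gcongr; exact enorm_integral_le_lintegral_enorm _
    _ = ∫⁻ y, ‖Kf (z-y) * cv (dl (t/2^k) Φ) f y‖ₑ * ENNReal.ofReal (((1+‖x-z‖/t)^L)⁻¹) := by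
        rw [lintegral_mul_const']; exact ENNReal.ofReal_ne_top
    _ ≤ ∫⁻ y, ENNReal.ofReal (C0 * 2^(k*L)) * (Pm Φ f L x)^(1-r) *
       (ENNReal.ofReal ((t^n)⁻¹ * ((1+‖x-y‖/t)^(n+1))⁻¹) * (radMax n Φ f y)^r) := lintegral_mono hpt
    _ = ENNReal.ofReal (C0 * 2^(k*L)) * (Pm Φ f L x)^(1-r) * ∫⁻ y,
       (ENNReal.ofReal ((t^n)⁻¹ * ((1+‖x-y‖/t)^(n+1))⁻¹) * (radMax n Φ f y)^r) := by
        rw [lintegral_const_mul']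
        exact ENNReal.mul_ne_top ENNReal.ofReal_ne_top
          (ENNReal.rpow_ne_top_of_nonneg (by linarith) (Pm_fin Φ f L x))
    _ ≤ ENNReal.ofReal (C0 * 2^(k*L)) * (Pm Φ f L x)^(1-r) *
        (ENNReal.ofReal (2^(n+2)) * HL n (fun y => (radMax n Φ f y)^r) x) := by gcongr
    _ = _ := by
        rw [ENNReal.ofReal_mul (p := C0 * 2^(k*L)) (by positivity)]; ring

lemma geo_half (J : ℕ) : ∑ k ∈ Finset.range J, ((1/2:ℝ))^(k+1) ≤ 1 := by
  have : ∀ J : ℕ, ∑ k ∈ Finset.range J, ((1/2:ℝ))^(k+1) = 1 - (1/2)^J := by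
    intro J
    induction J with
    | zero => simp
    | succ J ih => rw [Finset.sum_range_succ, ih]; ring
  rw [this]
  have : (0:ℝ) ≤ (1/2)^J := by positivity
  linarith

lemma Pm_le {n : ℕ} (Φ : 𝓢(En n, ℂ)) (hΦ : (∫ x, Φ x) ≠ 0) (L : ℕ) (r : ℝ) (hr : 0 < r) (hr1 : r ≤ 1)
    (hL : (n:ℝ)+1 ≤ L*r) :
    ∃ C : ℝ≥0∞, C ≠ ∞ ∧ ∀ (f : 𝓢(En n, ℂ)) x,
      Pm Φ f L x ≤ C * (HL n (fun y => (radMax n Φ f y)^r) x)^(1/r) := by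
  obtain ⟨a, ha, Θ, ψ, ρ, Φ', h1, h2, h3, h4⟩ := setupΦ Φ hΦ (L+1)
  obtain ⟨C0, hC0, hd0⟩ := cvdec Φ ψ L
  obtain ⟨C1, hC1, hd1⟩ := cvdec Φ' ρ L
  set C := ENNReal.ofReal ((C0 + C1) * 2^(n+2)) with hC
  refine ⟨C^(1/r), ENNReal.rpow_ne_top_of_nonneg (by positivity) ENNReal.ofReal_ne_top, fun f x => ?_⟩
  set Q := (Pm Φ f L x)^(1-r) * HL n (fun y => (radMax n Φ f y)^r) x with hQ
  have key : Pm Φ f L x ≤ C * Q := by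
    refine iSup_le fun t => iSup_le fun ht => iSup_le fun z => ?_
    have hlim := apx Θ (h1 0 (by simpa using ha.le)) (cv (dl t Φ) f) t ht z
    have hlim2 : Filter.Tendsto (fun J : ℕ => ‖cv (dl (t/2^J) Θ) (cv (dl t Φ) f) z‖ₑ *
        ENNReal.ofReal (((1+‖x-z‖/t)^L)⁻¹)) Filter.atTop
        (nhds (‖cv (dl t Φ) f z‖ₑ * ENNReal.ofReal (((1+‖x-z‖/t)^L)⁻¹))) :=
      ENNReal.Tendsto.mul_const hlim.enorm (Or.inr ENNReal.ofReal_ne_top)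
    refine le_of_tendsto' hlim2 fun J => ?_
    rw [tele Φ Θ ψ ρ Φ' (L+1) h2 h3 h4 f t ht J]
    have hs0 := step Φ f (cv (dl t Φ) (dl t ψ)) 0 L r C0 hr hr1 hL hC0 t ht (hd0 t t ht le_rfl) x z
    have hsk := fun k : ℕ => step Φ f (cv (dl t Φ') (dl (t/2^k) ρ)) k L r C1 hr hr1 hL hC1 t ht
      (hd1 t (t/2^k) (by positivity) (div_le_self ht.le (one_le_pow₀ (by norm_num)))) x z
    simp only [pow_zero, div_one, zero_mul, mul_one] at hs0
    set w := ENNReal.ofReal (((1+‖x-z‖/t)^L)⁻¹) with hw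
    rw [add_apply, sum_apply]
    have hsum : ‖∑ k ∈ Finset.range J, ((((1/4:ℝ)^((L+1)*(k+1)) : ℝ):ℂ) •
        cv (cv (dl t Φ') (dl (t/2^(k+1)) ρ)) (cv (dl (t/2^(k+1)) Φ) f)) z‖ₑ * w ≤
        ENNReal.ofReal (C1 * 2^(n+2)) * Q := by
      calc _ ≤ (∑ k ∈ Finset.range J, ‖((((1/4:ℝ)^((L+1)*(k+1)) : ℝ):ℂ) •
            cv (cv (dl t Φ') (dl (t/2^(k+1)) ρ)) (cv (dl (t/2^(k+1)) Φ) f)) z‖ₑ) * w := by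
            gcongr; exact enorm_sum_le _ _
        _ = ∑ k ∈ Finset.range J, ENNReal.ofReal ((1/4:ℝ)^((L+1)*(k+1))) *
            (‖cv (cv (dl t Φ') (dl (t/2^(k+1)) ρ)) (cv (dl (t/2^(k+1)) Φ) f) z‖ₑ * w) := by
            rw [Finset.sum_mul]
            refine Finset.sum_congr rfl fun k _ => ?_
            rw [smul_apply, enorm_smul, ← ofReal_norm (((((1/4:ℝ)^((L+1)*(k+1)) : ℝ):ℂ))),
              Complex.norm_real, Real.norm_of_nonneg (by positivity), mul_assoc]
        _ ≤ ∑ k ∈ Finset.range J, ENNReal.ofReal ((1/4:ℝ)^((L+1)*(k+1))) *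
            (ENNReal.ofReal (C1 * 2^((k+1)*L) * 2^(n+2)) * Q) := by
            refine Finset.sum_le_sum fun k _ => ?_
            exact mul_le_mul_right (hsk (k+1)) _
        _ = ENNReal.ofReal (∑ k ∈ Finset.range J, (1/4:ℝ)^((L+1)*(k+1)) *
            (C1 * 2^((k+1)*L) * 2^(n+2))) * Q := by
            rw [ENNReal.ofReal_sum_of_nonneg (fun _ _ => by positivity), Finset.sum_mul]
            refine Finset.sum_congr rfl fun k _ => ?_
            rw [ENNReal.ofReal_mul (p := (1/4:ℝ)^((L+1)*(k+1))) (by positivity)]; ring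
        _ ≤ _ := by
            gcongr ENNReal.ofReal ?_ * _
            calc _ ≤ ∑ k ∈ Finset.range J, ((1/2:ℝ)^(k+1)) * (C1 * 2^(n+2)) := by
                  refine Finset.sum_le_sum fun k _ => ?_
                  have : (1/4:ℝ)^((L+1)*(k+1)) * 2^((k+1)*L) ≤ (1/2)^(k+1) := by
                    rw [mul_comm (k+1) L, pow_mul, pow_mul, ← mul_pow]
                    gcongr
                    rw [pow_succ, mul_right_comm, ← mul_pow]
                    have : ((1/4:ℝ)*2)^L ≤ 1 := pow_le_one₀ (by norm_num) (by norm_num)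
                    linarith
                  calc _ = ((1/4:ℝ)^((L+1)*(k+1)) * 2^((k+1)*L)) * (C1 * 2^(n+2)) := by ring
                    _ ≤ _ := by gcongr
              _ = (∑ k ∈ Finset.range J, ((1/2:ℝ)^(k+1))) * (C1 * 2^(n+2)) := by rw [Finset.sum_mul]
              _ ≤ 1 * (C1 * 2^(n+2)) := by gcongr; exact geo_half J
              _ = _ := one_mul _
    calc _ ≤ (‖cv (cv (dl t Φ) (dl t ψ)) (cv (dl t Φ) f) z‖ₑ + ‖∑ k ∈ Finset.range J, ((((1/4:ℝ)^((L+1)*(k+1)) : ℝ):ℂ) •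
        cv (cv (dl t Φ') (dl (t/2^(k+1)) ρ)) (cv (dl (t/2^(k+1)) Φ) f)) z‖ₑ) * w := by
          gcongr; exact enorm_add_le _ _
      _ ≤ ENNReal.ofReal (C0 * 2^(n+2)) * Q + ENNReal.ofReal (C1 * 2^(n+2)) * Q := by
          rw [add_mul]; exact add_le_add hs0 hsum
      _ = C * Q := by
          rw [← add_mul, ← ENNReal.ofReal_add (by positivity) (by positivity), hC]; congr 2; ring
  by_cases h0 : Pm Φ f L x = 0
  · rw [h0]; simp
  have hf := Pm_fin Φ f L x
  set H := HL n (fun y => (radMax n Φ f y)^r) x with hH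
  have hr2 : (Pm Φ f L x)^r ≤ C * H := by
    have e1 : Pm Φ f L x = (Pm Φ f L x)^r * (Pm Φ f L x)^(1-r) := by
      rw [← ENNReal.rpow_add _ _ h0 hf]; simp
    have hne : (Pm Φ f L x)^(1-r) ≠ 0 := by
      intro h; rcases ENNReal.rpow_eq_zero_iff.1 h with h | h
      · exact h0 h.1
      · exact hf h.1
    have hnt : (Pm Φ f L x)^(1-r) ≠ ∞ := ENNReal.rpow_ne_top_of_nonneg (by linarith) hf
    rw [← ENNReal.mul_le_mul_iff_left hne hnt, ← e1]
    calc _ ≤ _ := key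
      _ = _ := by rw [hQ]; ring
  calc Pm Φ f L x = ((Pm Φ f L x)^r)^(1/r) := by
        rw [← ENNReal.rpow_mul, mul_one_div_cancel hr.ne', ENNReal.rpow_one]
    _ ≤ (C * H)^(1/r) := by gcongr
    _ = _ := ENNReal.mul_rpow_of_nonneg _ _ (by positivity)



lemma Gb_core {n : ℕ} (Φ κ f : 𝓢(En n, ℂ)) (L : ℕ) (C0 τ v : ℝ) (hC0 : 0 ≤ C0) (hτ : 0 < τ) (hv : τ ≤ v)
    (hκ : ∀ w, ‖κ w‖ ≤ C0 * ((τ^n)⁻¹ * ((1+‖w‖/τ)^(L+(n+1)))⁻¹)) (y y' : En n) :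
    ‖cv κ (cv (dl v Φ) f) y‖ₑ ≤ ENNReal.ofReal C0 * JI n ((n:ℝ)+1) * ENNReal.ofReal ((1+‖y-y'‖/τ)^L) *
      Pm Φ f L y' := by
  have hvp : 0 < v := hτ.trans_le hv
  have hP := Pm_fin Φ f L y'
  have hpt : ∀ w, ‖κ (y-w) * cv (dl v Φ) f w‖ₑ ≤
      (ENNReal.ofReal (C0 * (τ^n)⁻¹ * (1+‖y-y'‖/τ)^L) * Pm Φ f L y') *
        ENNReal.ofReal ((1+‖w-y‖/τ)^(-((n:ℝ)+1))) := by
    intro w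
    rw [enorm_mul]
    have h1 := Pm_ge Φ f L y' w hvp
    have h2 : ‖κ (y-w)‖ₑ ≤ ENNReal.ofReal (C0 * ((τ^n)⁻¹ * ((1+‖y-w‖/τ)^(L+(n+1)))⁻¹)) := by
      rw [← ofReal_norm]; exact ENNReal.ofReal_le_ofReal (hκ _)
    calc ‖κ (y-w)‖ₑ * ‖cv (dl v Φ) f w‖ₑ ≤ ENNReal.ofReal (C0 * ((τ^n)⁻¹ * ((1+‖y-w‖/τ)^(L+(n+1)))⁻¹)) *
          (Pm Φ f L y' * ENNReal.ofReal ((1+‖y'-w‖/v)^L)) := by gcongr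
      _ = ENNReal.ofReal (C0 * ((τ^n)⁻¹ * ((1+‖y-w‖/τ)^(L+(n+1)))⁻¹) * (1+‖y'-w‖/v)^L) * Pm Φ f L y' := by
          rw [ENNReal.ofReal_mul (p := C0 * ((τ^n)⁻¹ * ((1+‖y-w‖/τ)^(L+(n+1)))⁻¹)) (by positivity)]; ring
      _ ≤ ENNReal.ofReal ((C0 * (τ^n)⁻¹ * (1+‖y-y'‖/τ)^L) * (1+‖w-y‖/τ)^(-((n:ℝ)+1))) * Pm Φ f L y' := by
          gcongr ENNReal.ofReal ?_ * _
          have e1 : (1+‖w-y‖/τ)^(-((n:ℝ)+1)) = ((1+‖y-w‖/τ)^(n+1))⁻¹ := by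
            rw [norm_sub_rev, Real.rpow_neg (by positivity), ← Real.rpow_natCast]; push_cast; rfl
          have h3 : (1+‖y'-w‖/v)^L ≤ (1+‖y-y'‖/τ)^L * (1+‖y-w‖/τ)^L := by
            rw [← mul_pow]
            gcongr
            calc 1+‖y'-w‖/v ≤ 1+‖y'-w‖/τ := by gcongr
              _ ≤ _ := by
                have := peetre (y'-w) (y-w) hτ
                rw [sub_sub_sub_cancel_right, norm_sub_rev y' y] at this
                exact this
          rw [e1, pow_add]
          calc _ ≤ C0 * ((τ^n)⁻¹ * ((1+‖y-w‖/τ)^L * (1+‖y-w‖/τ)^(n+1))⁻¹) * ((1+‖y-y'‖/τ)^L * (1+‖y-w‖/τ)^L) := by gcongr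
            _ = _ := by field_simp
      _ = _ := by
          rw [ENNReal.ofReal_mul (p := (C0 * (τ^n)⁻¹ * (1+‖y-y'‖/τ)^L)) (by positivity)]; ring
  rw [cv_apply]
  calc _ ≤ ∫⁻ w, ‖κ (y-w) * cv (dl v Φ) f w‖ₑ := enorm_integral_le_lintegral_enorm _
    _ ≤ ∫⁻ w, (ENNReal.ofReal (C0 * (τ^n)⁻¹ * (1+‖y-y'‖/τ)^L) * Pm Φ f L y') *
        ENNReal.ofReal ((1+‖w-y‖/τ)^(-((n:ℝ)+1))) := lintegral_mono hpt
    _ = (ENNReal.ofReal (C0 * (τ^n)⁻¹ * (1+‖y-y'‖/τ)^L) * Pm Φ f L y') *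
        (ENNReal.ofReal (τ^n) * JI n ((n:ℝ)+1)) := by
        rw [lintegral_const_mul' _ _ (ENNReal.mul_ne_top ENNReal.ofReal_ne_top hP), JI_scale n _ y τ hτ]
    _ = ENNReal.ofReal (C0 * (τ^n)⁻¹ * (1+‖y-y'‖/τ)^L * τ^n) * Pm Φ f L y' * JI n ((n:ℝ)+1) := by
        rw [ENNReal.ofReal_mul (p := C0 * (τ^n)⁻¹ * (1+‖y-y'‖/τ)^L) (by positivity)]; ring
    _ = _ := by
        have : C0 * (τ^n)⁻¹ * (1+‖y-y'‖/τ)^L * τ^n = C0 * (1+‖y-y'‖/τ)^L := by field_simp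
        rw [this, ENNReal.ofReal_mul hC0]; ring

lemma Gbound {n : ℕ} (Φ Θ ψ : 𝓢(En n, ℂ)) (a : ℝ) (ha : 0 < a) (h2 : ∀ ξ, 𝓕 ψ ξ * 𝓕 Φ ξ = 𝓕 Θ ξ) (L : ℕ) :
    ∃ C : ℝ≥0∞, C ≠ ∞ ∧ ∀ (f : 𝓢(En n, ℂ)) (ε t : ℝ), 0 < ε → 0 < t → ∀ y y',
      ‖cv (dl t Φ) (cv (dl (a*ε) Θ) f) y‖ₑ ≤ C * ENNReal.ofReal ((1+‖y-y'‖/ε)^L) * Pm Φ f L y' := by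
  obtain ⟨C0, hC0, hd⟩ := cvdec ψ Φ (L+(n+1))
  refine ⟨ENNReal.ofReal C0 * JI n ((n:ℝ)+1) * ENNReal.ofReal ((1+a⁻¹)^L), ?_, ?_⟩
  · exact ENNReal.mul_ne_top (ENNReal.mul_ne_top ENNReal.ofReal_ne_top (JI_fin n _ (by linarith)))
      ENNReal.ofReal_ne_top
  intro f ε t hε ht y y'
  set τ := a*ε with hτd
  have hτ : 0 < τ := by positivity
  have main : ‖cv (dl t Φ) (cv (dl τ Θ) f) y‖ₑ ≤ ENNReal.ofReal C0 * JI n ((n:ℝ)+1) *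
      ENNReal.ofReal ((1+‖y-y'‖/τ)^L) * Pm Φ f L y' := by
    rcases le_total t τ with h | h
    · have e : cv (dl t Φ) (cv (dl τ Θ) f) = cv (cv (dl τ ψ) (dl t Φ)) (cv (dl τ Φ) f) := by
        apply fou_ext; intro ξ
        simp only [cv_fou, dl_fou ht, dl_fou hτ, ← h2]; ring
      rw [e]
      exact Gb_core Φ _ f L C0 τ τ hC0 hτ le_rfl (hd τ t ht h) y y'
    · have e : cv (dl t Φ) (cv (dl τ Θ) f) = cv (cv (dl τ ψ) (dl τ Φ)) (cv (dl t Φ) f) := by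
        apply fou_ext; intro ξ
        simp only [cv_fou, dl_fou ht, dl_fou hτ, ← h2]; ring
      rw [e]
      exact Gb_core Φ _ f L C0 τ t hC0 hτ h (hd τ τ hτ le_rfl) y y'
  refine main.trans ?_
  have : ENNReal.ofReal ((1+‖y-y'‖/τ)^L) ≤ ENNReal.ofReal ((1+a⁻¹)^L) * ENNReal.ofReal ((1+‖y-y'‖/ε)^L) := by
    rw [← ENNReal.ofReal_mul (by positivity), ← mul_pow]
    apply ENNReal.ofReal_le_ofReal
    gcongr
    have e : ‖y-y'‖/τ = a⁻¹ * (‖y-y'‖/ε) := by rw [hτd]; field_simp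
    rw [e]
    have h1 : 0 ≤ ‖y-y'‖/ε := by positivity
    have h2 : 0 < a⁻¹ := by positivity
    nlinarith
  calc _ ≤ ENNReal.ofReal C0 * JI n ((n:ℝ)+1) *
      (ENNReal.ofReal ((1+a⁻¹)^L) * ENNReal.ofReal ((1+‖y-y'‖/ε)^L)) * Pm Φ f L y' := by gcongr
    _ = _ := by ring



lemma pairF {n : ℕ} (Ψ : 𝓢(En n, ℂ)) (k : En n → ℂ) (hk : Integrable k) (x : En n) :
    ∫ y, Ψ (x - y) * 𝓕 k y = 𝓕 (fun ξ => 𝓕 Ψ (-ξ) * k ξ) x := by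
  have hI : Integrable (fun y => Ψ (x - y)) := Ψ.integrable.comp_sub_left x
  have h : ∫ ξ, 𝓕 (fun y => Ψ (x - y)) ξ * k ξ = ∫ y, Ψ (x-y) * 𝓕 k y := by
    simpa using! VectorFourier.integral_bilin_fourierIntegral_eq_flip (ContinuousLinearMap.mul ℂ ℂ)
      (L := innerₗ (En n)) continuous_fourierChar continuous_inner hI hk
  rw [← h, Real.fourier_eq]
  congr 1; ext ξ
  have e : 𝓕 (fun y => Ψ (x - y)) ξ = Real.fourierChar (-(inner ℝ ξ x)) • 𝓕 Ψ (-ξ) := by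
    rw [SchwartzMap.fourier_coe, Real.fourier_eq, Real.fourier_eq,
      ← integral_sub_left_eq_self (fun y => Real.fourierChar (-(inner ℝ y ξ)) • Ψ (x-y)) _ x]
    rw [Circle.smul_def, ← integral_smul]
    congr 1; ext y
    rw [sub_sub_cancel, ← Circle.smul_def, smul_smul, ← AddChar.map_add_eq_mul]
    congr 2
    rw [inner_sub_left, inner_neg_right, real_inner_comm]; ring
  rw [e]
  simp [Circle.smul_def, mul_assoc]

lemma brKD_eq (n : ℕ) (δ ε : ℝ) (hε : 0 < ε) (z : En n) :
    brKernelDil n δ ε z = 𝓕 (fun ξ : En n => (brm n δ (ε • ξ) : ℂ)) z := by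
  unfold brKernelDil brKernel
  rw [Real.fourier_eq']
  have := Measure.integral_comp_smul (volume : Measure (En n))
    (fun ξ => (((max (1 - ‖ξ‖ ^ 2) 0) ^ δ : ℝ) : ℂ) *
    Complex.exp (-(2 * Real.pi) * Complex.I * ((∑ i, (ε⁻¹ • z) i * ξ i : ℝ) : ℂ))) ε
  rw [finrank_euclideanSpace_fin, abs_of_pos (by positivity)] at this
  rw [← this]
  congr 1; ext ξ
  rw [smul_eq_mul, mul_comm]
  congr 2
  have e : (∑ i, (ε⁻¹ • z) i * (ε • ξ) i : ℝ) = inner ℝ ξ z := by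
    rw [PiLp.inner_apply]
    refine Finset.sum_congr rfl fun i _ => ?_
    simp; field_simp
  rw [e]
  push_cast; ring

lemma brmε_int (n : ℕ) (δ ε : ℝ) (hδ : 0 < δ) (hε : 0 < ε) :
    Integrable (fun ξ : En n => (brm n δ (ε • ξ) : ℂ)) :=
  ((brm_integrable n δ hδ).comp_smul hε.ne').ofReal

lemma brM_eq {n : ℕ} (δ ε : ℝ) (hδ : 0 < δ) (hε : 0 < ε) (f : 𝓢(En n, ℂ)) (x : En n) :
    brMeans n δ ε f x = 𝓕 (fun ξ : En n => 𝓕 f (-ξ) * (brm n δ (ε • ξ) : ℂ)) x := by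
  rw [← pairF f _ (brmε_int n δ ε hδ hε)]
  unfold brMeans
  rw [← integral_sub_left_eq_self (fun y => f y * brKernelDil n δ ε (x-y)) _ x]
  simp only [sub_sub_cancel, brKD_eq n δ ε hε]

lemma brM_cut {n : ℕ} (δ ε a : ℝ) (hδ : 0 < δ) (hε : 0 < ε) (ha : 0 < a) (Θ f : 𝓢(En n, ℂ))
    (hΘ : ∀ ξ, ‖ξ‖ ≤ a → 𝓕 Θ ξ = 1) :
    brMeans n δ ε f = brMeans n δ ε (cv (dl (a*ε) Θ) f) := by
  ext x
  rw [brM_eq δ ε hδ hε, brM_eq δ ε hδ hε]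
  refine congrArg (fun F : En n → ℂ => 𝓕 F x) (funext fun ξ => ?_)
  rw [cv_fou, dl_fou (by positivity)]
  by_cases h : ‖ε • ξ‖ ≤ 1
  · rw [hΘ, one_mul]
    rw [mul_smul, norm_smul, smul_neg, norm_neg, Real.norm_of_nonneg ha.le]
    nlinarith
  · rw [brm_supp n δ hδ _ (by linarith)]; simp

lemma rad_br {n : ℕ} (δ ε : ℝ) (hδ : 0 < δ) (hε : 0 < ε) (Φ f : 𝓢(En n, ℂ)) {t : ℝ} (ht : 0 < t) (x : En n) :
    ∫ y, ((t^n)⁻¹ : ℝ) • Φ (t⁻¹ • (x-y)) * brMeans n δ ε f y = brMeans n δ ε (cv (dl t Φ) f) x := by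
  rw [brM_eq δ ε hδ hε]
  have hk : Integrable (fun ξ : En n => 𝓕 f (-ξ) * (brm n δ (ε • ξ) : ℂ)) := by
    obtain ⟨B, hB, hb⟩ := cv_bdd (𝓕 f)
    refine (brmε_int n δ ε hδ hε).bdd_mul (c := B) ?_ ?_
    · exact ((𝓕 f).continuous.comp continuous_neg).aestronglyMeasurable
    · filter_upwards with ξ; exact hb _
  have := pairF (dl t Φ) _ hk x
  simp only [dl_apply ht] at this
  simp only [brM_eq δ ε hδ hε]
  rw [this]
  refine congrArg (fun F : En n → ℂ => 𝓕 F x) (funext fun ξ => ?_)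
  rw [cv_fou]; ring

/-- the main pointwise bound -/
lemma rad_main {n : ℕ} (hn : 1 ≤ n) (δ : ℝ) (hδ : ((n:ℝ)-1)/2 < δ) (Φ : 𝓢(En n, ℂ)) (hΦ : (∫ x, Φ x) ≠ 0)
    (L : ℕ) : ∃ C : ℝ≥0∞, C ≠ ∞ ∧ ∀ (f : 𝓢(En n, ℂ)) (ε : ℝ), 0 < ε → ∀ x,
      radMax n Φ (brMeans n δ ε f) x ≤ ∑' k, cinf n ε (fun y => C * Pm Φ f L y) k *
        ENNReal.ofReal ((1+‖x - lat n ε k‖/ε)^(-(((n:ℝ)+1)/2+δ))) := by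
  have hδ0 : 0 < δ := by
    have : (1:ℝ) ≤ n := by exact_mod_cast hn
    linarith
  obtain ⟨a, ha, Θ, ψ, ρ, Φ', h1, h2, h3, h4⟩ := setupΦ Φ hΦ 0
  obtain ⟨CG, hCG, hG⟩ := Gbound Φ Θ ψ a ha h2 L
  obtain ⟨Cφ, hCφ, hφ⟩ := brKernel_decay n hn δ hδ
  set l := ((n:ℝ)+1)/2+δ with hl
  have hl0 : 0 < l := by positivity
  set C : ℝ≥0∞ := CG * ENNReal.ofReal ((1+2*n)^L * Cφ * (1+n)^l) with hC
  have hCt : C ≠ ∞ := ENNReal.mul_ne_top hCG ENNReal.ofReal_ne_top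
  refine ⟨C, hCt, fun f ε hε x => ?_⟩
  unfold radMax
  refine iSup_le fun t => iSup_le fun ht => ?_
  rw [brM_cut δ ε a hδ0 hε ha Θ f h1, rad_br δ ε hδ0 hε Φ _ ht x]
  set g := cv (dl t Φ) (cv (dl (a*ε) Θ) f) with hg
  change ‖brMeans n δ ε g x‖ₑ ≤ _
  unfold brMeans
  refine (enorm_integral_le_lintegral_enorm _).trans ?_
  have hcov : (⋃ k, cell n ε k) = univ := by
    rw [eq_univ_iff_forall]; intro y; rw [mem_iUnion]; exact cell_cover n ε hε y
  rw [← setLIntegral_univ, ← hcov, lintegral_iUnion (fun k => cell_meas n ε k) (cell_disj n ε hε)]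
  refine ENNReal.tsum_le_tsum fun k => ?_
  set W := (1+‖x - lat n ε k‖/ε)^(-l) with hW
  have hWpos : 0 < W := by positivity
  have hpt : ∀ y ∈ cell n ε k, ‖g y * brKernelDil n δ ε (x-y)‖ₑ ≤
      cinf n ε (fun y => C * Pm Φ f L y) k * ENNReal.ofReal W * ENNReal.ofReal ((ε^n)⁻¹) := by
    intro y hy
    have hker : ‖brKernelDil n δ ε (x-y)‖ ≤ (ε^n)⁻¹ * (Cφ * ((1+n)^l * W)) := by
      unfold brKernelDil
      rw [norm_smul, Real.norm_of_nonneg (by positivity)]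
      gcongr
      refine (hφ _).trans ?_
      gcongr
      have hd := cell_dist n ε hε k y hy
      have h5 : 1+‖x - lat n ε k‖/ε ≤ (1+n) * (1+‖ε⁻¹ • (x-y)‖) := by
        rw [norm_smul, Real.norm_of_nonneg (by positivity), ← div_eq_inv_mul]
        have h6 := peetre (x - lat n ε k) (y - lat n ε k) hε
        rw [sub_sub_sub_cancel_right] at h6
        have h7 : ‖y - lat n ε k‖/ε ≤ n := by rw [div_le_iff₀ hε]; exact hd
        calc _ ≤ _ := h6
          _ ≤ (1+‖x-y‖/ε) * (1+n) := by gcongr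
          _ = _ := mul_comm _ _
      rw [hW, Real.rpow_neg (by positivity), Real.rpow_neg (by positivity), ← div_eq_mul_inv,
        le_div_iff₀ (by positivity), inv_mul_le_iff₀ (by positivity), mul_comm,
        ← Real.mul_rpow (by positivity) (by positivity)]
      exact Real.rpow_le_rpow (by positivity) h5 hl0.le
    have hkerE : ‖brKernelDil n δ ε (x-y)‖ₑ ≤ ENNReal.ofReal ((ε^n)⁻¹ * (Cφ * ((1+n)^l * W))) := by
      rw [← ofReal_norm]; exact ENNReal.ofReal_le_ofReal hker
    have hgE : ENNReal.ofReal (Cφ * (1+n)^l) * ‖g y‖ₑ ≤ cinf n ε (fun y => C * Pm Φ f L y) k := by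
      unfold cinf
      refine le_iInf₂ fun y' hy' => ?_
      have h8 := hG f ε t hε ht y y'
      have h9 : (1+‖y-y'‖/ε) ≤ 1+2*n := by
        have d1 := cell_dist n ε hε k y hy
        have d2 := cell_dist n ε hε k y' hy'
        have d3 : ‖y-y'‖ ≤ 2*n*ε := by
          have : y - y' = (y - lat n ε k) - (y' - lat n ε k) := by abel
          rw [this]
          refine (norm_sub_le _ _).trans ?_
          linarith
        have : ‖y-y'‖/ε ≤ 2*n := by rw [div_le_iff₀ hε]; exact d3
        linarith
      calc ENNReal.ofReal (Cφ * (1+n)^l) * ‖g y‖ₑ ≤ ENNReal.ofReal (Cφ * (1+n)^l) *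
            (CG * ENNReal.ofReal ((1+2*n)^L) * Pm Φ f L y') := by
            refine mul_le_mul_right (h8.trans ?_) _
            gcongr
        _ = _ := by
            rw [hC, mul_assoc ((1+2*(n:ℝ))^L), ENNReal.ofReal_mul (p := (1+2*(n:ℝ))^L) (by positivity)]; ring
    rw [enorm_mul]
    calc ‖g y‖ₑ * ‖brKernelDil n δ ε (x-y)‖ₑ ≤ ‖g y‖ₑ * ENNReal.ofReal ((ε^n)⁻¹ * (Cφ * ((1+n)^l * W))) := by
          gcongr
      _ = (ENNReal.ofReal (Cφ * (1+n)^l) * ‖g y‖ₑ) * ENNReal.ofReal W * ENNReal.ofReal ((ε^n)⁻¹) := by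
          have : (ε^n)⁻¹ * (Cφ * ((1+n)^l * W)) = Cφ * (1+n)^l * W * (ε^n)⁻¹ := by ring
          rw [this, ENNReal.ofReal_mul (p := Cφ * (1+n)^l * W) (by positivity),
            ENNReal.ofReal_mul (p := Cφ * (1+n)^l) (by positivity)]; ring
      _ ≤ _ := by gcongr
  calc _ ≤ ∫⁻ y in cell n ε k, cinf n ε (fun y => C * Pm Φ f L y) k * ENNReal.ofReal W * ENNReal.ofReal ((ε^n)⁻¹) :=
        setLIntegral_mono' (cell_meas n ε k) hpt
    _ = cinf n ε (fun y => C * Pm Φ f L y) k * ENNReal.ofReal W * (ENNReal.ofReal ((ε^n)⁻¹) * ENNReal.ofReal (ε^n)) := by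
        rw [setLIntegral_const, cell_vol n ε hε]; ring
    _ = _ := by
        rw [← ENNReal.ofReal_mul (by positivity), inv_mul_cancel₀ (by positivity)]; simp



lemma vol_ball_rpow (n : ℕ) (x : En n) (R s : ℝ) (hR : 0 < R) (hs : 0 ≤ s) :
    (volume (Metric.ball x R))^s = (vB n)^s * ENNReal.ofReal (R^((n:ℝ)*s)) := by
  rw [vol_ball n x hR, ENNReal.mul_rpow_of_nonneg _ _ hs, ENNReal.ofReal_rpow_of_nonneg (by positivity) hs,
    ← Real.rpow_natCast, ← Real.rpow_mul hR.le, mul_comm]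

lemma morrey_out (n : ℕ) (p q : ℝ) (hq0 : 0 < q) (hqp : q ≤ p) (g : En n → ℝ≥0∞) (x : En n) (R : ℝ) (hR : 0 < R) :
    ∫⁻ y in Metric.ball x R, (g y)^q ≤
      ((morreyQ n p q g)^q * (vB n)^(1-q/p)) * ENNReal.ofReal (R^((n:ℝ)*(1-q/p))) := by
  have hp : 0 < p := hq0.trans_le hqp
  have hs : 0 ≤ 1-q/p := by rw [sub_nonneg, div_le_one hp]; exact hqp
  rw [mul_assoc, ← vol_ball_rpow n x R _ hR hs]
  set V := volume (Metric.ball x R) with hV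
  have hV0 : V ≠ 0 := (Metric.measure_ball_pos volume x hR).ne'
  have hVt : V ≠ ∞ := measure_ball_lt_top.ne
  set I := ∫⁻ y in Metric.ball x R, (g y)^q
  have h : V^(1/p-1/q) * I^(1/q) ≤ morreyQ n p q g :=
    le_iSup_of_le x (le_iSup_of_le R (le_iSup_of_le hR le_rfl))
  have h2 := ENNReal.rpow_le_rpow h hq0.le
  rw [ENNReal.mul_rpow_of_nonneg _ _ hq0.le, ← ENNReal.rpow_mul, ← ENNReal.rpow_mul,
    one_div_mul_cancel hq0.ne', ENNReal.rpow_one] at h2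
  have e : (1/p-1/q)*q = -(1-q/p) := by field_simp; ring
  rw [e] at h2
  calc I = V^(-(1-q/p)) * I * V^(1-q/p) := by
        rw [mul_right_comm, ← ENNReal.rpow_add _ _ hV0 hVt]; simp
    _ ≤ _ := by gcongr

lemma morrey_in (n : ℕ) (p q : ℝ) (hq0 : 0 < q) (hqp : q ≤ p) (F : En n → ℝ≥0∞) (A D : ℝ≥0∞)
    (h : ∀ b : ℝ≥0∞, b ≠ 0 → b ≠ ∞ → ∀ x0 R, 0 < R → b^q * volume ({x | b < F x} ∩ Metric.ball x0 R) ≤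
      D * (A^q * (vB n)^(1-q/p)) * ENNReal.ofReal (R^((n:ℝ)*(1-q/p)))) :
    morreyWQ n p q F ≤ D^(1/q) * A := by
  have hp : 0 < p := hq0.trans_le hqp
  have hs : 0 ≤ 1-q/p := by rw [sub_nonneg, div_le_one hp]; exact hqp
  unfold morreyWQ
  refine iSup_le fun β => iSup_le fun hβ => ?_
  unfold morreyQ
  simp only [ENNReal.mul_iSup]
  refine iSup_le fun x => iSup_le fun R => iSup_le fun hR => ?_
  have h1 := h β (by exact_mod_cast hβ.ne') ENNReal.coe_ne_top x R hR
  rw [mul_assoc, mul_assoc, ← vol_ball_rpow n x R _ hR hs] at h1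
  set V := volume (Metric.ball x R) with hV
  have hV0 : V ≠ 0 := (Metric.measure_ball_pos volume x hR).ne'
  have hVt : V ≠ ∞ := measure_ball_lt_top.ne
  set S := {x | (β:ℝ≥0∞) < F x} with hS
  have h2 : ∫⁻ y in Metric.ball x R, (S.indicator (1 : En n → ℝ≥0∞) y)^q ≤ volume (S ∩ Metric.ball x R) := by
    have e : ∀ y, (S.indicator (1 : En n → ℝ≥0∞) y)^q = S.indicator (fun _ => 1) y := by
      intro y; by_cases hy : y ∈ S
      · simp [hy]
      · simp [hy, hq0]
    simp only [e]
    refine (lintegral_indicator_const_le _ _).trans ?_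
    rw [one_mul, Measure.restrict_apply' Metric.isOpen_ball.measurableSet]
  have e : (1/p-1/q) = -(1-q/p)*(1/q) := by field_simp; ring
  calc (β:ℝ≥0∞) * (V^(1/p-1/q) * (∫⁻ y in Metric.ball x R, (S.indicator (1 : En n → ℝ≥0∞) y)^q)^(1/q))
      ≤ (β:ℝ≥0∞) * (V^(1/p-1/q) * (volume (S ∩ Metric.ball x R))^(1/q)) := by
        refine mul_le_mul_right (mul_le_mul_right (ENNReal.rpow_le_rpow h2 (by positivity)) _) _
    _ = ((β:ℝ≥0∞)^q * volume (S ∩ Metric.ball x R) * V^(-(1-q/p)))^(1/q) := by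
        rw [ENNReal.mul_rpow_of_nonneg _ _ (by positivity), ENNReal.mul_rpow_of_nonneg _ _ (by positivity),
          ← ENNReal.rpow_mul, ← ENNReal.rpow_mul, ← e, mul_one_div_cancel hq0.ne', ENNReal.rpow_one]
        ring
    _ ≤ (D * (A^q * V^(1-q/p)) * V^(-(1-q/p)))^(1/q) := by gcongr
    _ = (D * A^q)^(1/q) := by
        congr 1
        rw [mul_assoc, mul_assoc, ← ENNReal.rpow_add _ _ hV0 hVt]; simp
    _ = D^(1/q) * A := by
        rw [ENNReal.mul_rpow_of_nonneg _ _ (by positivity), ← ENNReal.rpow_mul,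
          mul_one_div_cancel hq0.ne', ENNReal.rpow_one]

lemma final_bound {n : ℕ} (hn : 1 ≤ n) (δ p q : ℝ)
    (hδ : ((n : ℝ) - 1) / 2 < δ)
    (hq0 : 0 < q) (hq1 : q ≤ 1) (hqp : q ≤ p)
    (hlow : 2 * (n : ℝ) / ((n : ℝ) + 1 + 2 * δ) ≤ q)
    (Φ : SchwartzMap (En n) ℂ) (hΦ : (∫ x, Φ x) ≠ 0) :
    ∃ C : ℝ≥0∞, C ≠ ∞ ∧ ∀ (f : SchwartzMap (En n) ℂ) (ε : ℝ), 0 < ε →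
      morreyWQ n p q (radMax n (⇑Φ) (brMeans n δ ε (⇑f))) ≤
        C * morreyQ n p q (radMax n (⇑Φ) (⇑f)) := by
  have hn' : (1:ℝ) ≤ n := by exact_mod_cast hn
  have hp : 0 < p := hq0.trans_le hqp
  have hs : 0 ≤ 1-q/p := by rw [sub_nonneg, div_le_one hp]; exact hqp
  have hs1 : 1-q/p < 1 := by have : 0 < q/p := by positivity
                             linarith
  set r := q/2 with hr
  have hr0 : 0 < r := by positivity
  obtain ⟨L, hL⟩ := exists_nat_ge (((n:ℝ)+1)/r)
  rw [div_le_iff₀ hr0] at hL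
  set l := ((n:ℝ)+1)/2+δ with hl
  set σ := (n:ℝ)*(1-q/p) with hσ
  have hσ0 : 0 ≤ σ := by positivity
  have hσn : σ < n := by rw [hσ]; nlinarith
  obtain ⟨C1, hC1, hP⟩ := Pm_le Φ hΦ L r hr0 (by linarith) hL
  obtain ⟨C2, hC2, hR⟩ := rad_main hn δ hδ Φ hΦ L
  obtain ⟨C3, hC3, hM⟩ := HL_morrey n hn σ hσ0 hσn.le
  obtain ⟨C4, hC4, hW⟩ := lattice_weak n hn q l σ hq0 hq1 (by rw [hl]; linarith) (by
    rw [div_le_iff₀ hq0, hl]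
    rw [div_le_iff₀ (by linarith)] at hlow
    nlinarith) hσ0 hσn
  refine ⟨(C4 * ((C2*C1)^q * C3))^(1/q), ENNReal.rpow_ne_top_of_nonneg (by positivity)
    (ENNReal.mul_ne_top hC4 (ENNReal.mul_ne_top (ENNReal.rpow_ne_top_of_nonneg hq0.le
      (ENNReal.mul_ne_top hC2 hC1)) hC3)), fun f ε hε => ?_⟩
  set M := radMax n Φ f with hMd
  set A := morreyQ n p q M with hA
  set T := A^q * (vB n)^(1-q/p) with hT
  have hMm : Measurable M := radMax_meas Φ f
  have hm : Measurable (fun y => (M y)^r) := hMm.pow_const r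
  have hM1 := hM (fun y => (M y)^r) hm T (by
    intro x R hR
    refine le_trans (le_of_eq ?_) (morrey_out n p q hq0 hqp M x R hR)
    congr 1; ext y
    rw [← ENNReal.rpow_two, ← ENNReal.rpow_mul, hr]; congr 1; ring)
  set H : En n → ℝ≥0∞ := fun y => (C2 * C1) * (HL n (fun y => (M y)^r) y)^(1/r) with hH
  have hHm : Measurable H := ((HL_meas n _).pow_const _).const_mul _
  have hHq : ∀ y, (H y)^q = (C2*C1)^q * (HL n (fun y => (M y)^r) y)^2 := by
    intro y
    rw [hH]; simp only
    rw [ENNReal.mul_rpow_of_nonneg _ _ hq0.le, ← ENNReal.rpow_mul, ← ENNReal.rpow_two]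
    congr 2; rw [hr]; field_simp
  have hfin : (C2*C1)^q ≠ ∞ := ENNReal.rpow_ne_top_of_nonneg hq0.le (ENNReal.mul_ne_top hC2 hC1)
  have hH1 : ∀ x R, 0 < R → ∫⁻ y in Metric.ball x R, (H y)^q ≤ ((C2*C1)^q * C3 * T) * ENNReal.ofReal (R^σ) := by
    intro x R hR
    simp only [hHq]
    rw [lintegral_const_mul' _ _ hfin]
    calc _ ≤ (C2*C1)^q * (C3 * T * ENNReal.ofReal (R^σ)) := mul_le_mul_right (hM1 x R hR) _
      _ = _ := by ring
  apply morrey_in n p q hq0 hqp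
  intro b hb0 hbt x0 R hRp
  refine (hW H hHm _ hH1 ε hε (radMax n Φ (brMeans n δ ε f)) ?_ b hb0 hbt x0 R hRp).trans (le_of_eq ?_)
  · intro x
    refine (hR f ε hε x).trans (ENNReal.tsum_le_tsum fun k => ?_)
    refine mul_le_mul_left ?_ _
    unfold cinf
    refine iInf₂_mono fun y _ => ?_
    rw [hH]; simp only
    rw [mul_assoc]
    exact mul_le_mul_right (hP f y) _
  · ring

theorem bochnerRiesz_hardyMorrey_to_weakHardyMorrey {n : ℕ} (hn : 1 ≤ n) (δ p q : ℝ)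
    (hδ : ((n : ℝ) - 1) / 2 < δ)
    (hq0 : 0 < q) (hq1 : q ≤ 1) (hqp : q ≤ p)
    (hlow : 2 * (n : ℝ) / ((n : ℝ) + 1 + 2 * δ) ≤ q)
    (Φ : SchwartzMap (En n) ℂ) (hΦ : (∫ x, Φ x) ≠ 0) :
    ∃ C : ℝ≥0, 0 < C ∧ ∀ (f : SchwartzMap (En n) ℂ) (ε : ℝ), 0 < ε →
      morreyWQ n p q (radMax n (⇑Φ) (brMeans n δ ε (⇑f))) ≤
        (C : ℝ≥0∞) * morreyQ n p q (radMax n (⇑Φ) (⇑f)) := by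
  obtain ⟨C, hC, h⟩ := final_bound hn δ p q hδ hq0 hq1 hqp hlow Φ hΦ
  refine ⟨C.toNNReal + 1, by positivity, fun f ε hε => (h f ε hε).trans ?_⟩
  gcongr
  rw [ENNReal.coe_add, ENNReal.coe_toNNReal hC]
  exact le_self_add
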